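/- arXiv:2404.01348 — 11 statements merged into one kernel-verified Lean document; each statement's English description precedes it below -/
import Mathlib

section
/- Let S be a compact metric space and θ a Borel probability measure on S. For every point x ∈ S and every Borel set A ⊆ S, the kernel value K^{θ,1,2}(x,A) := ∫_A (2·θ{z : d(x,z) > d(x,y)} + θ{z : d(x,z) = d(x,y)}) θ(dy) satisfies θ(A)² ≤ K^{θ,1,2}(x,A) ≤ 2·θ(A). -/
open MeasureTheory
open scoped ENNReal

/-- The transition kernel `K^{θ,1,2}(x,A)`: step to the nearer of two i.i.d. `θ`-samples,
ties broken uniformly. -/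
noncomputable def K12 {S : Type*} [MetricSpace S] [MeasurableSpace S]
    (θ : Measure S) (x : S) (A : Set S) : ℝ≥0∞ :=
  ∫⁻ y in A, (2 * θ {z | dist x y < dist x z} + θ {z | dist x z = dist x y}) ∂θ

/-- The integrand of `K12` is at most `2`. -/
theorem K12_density_le {S : Type*} [MetricSpace S] [MeasurableSpace S] [OpensMeasurableSpace S]
    (θ : Measure S) [IsProbabilityMeasure θ] (x y : S) :
    2 * θ {z | dist x y < dist x z} + θ {z | dist x z = dist x y} ≤ 2 := by
  have hE : MeasurableSet {z | dist x z = dist x y} :=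
    measurableSet_eq_fun (by fun_prop) (by fun_prop)
  have hdisj : Disjoint {z | dist x y < dist x z} {z | dist x z = dist x y} :=
    Set.disjoint_left.2 fun z hz hz' => hz.ne' hz'
  calc 2 * θ {z | dist x y < dist x z} + θ {z | dist x z = dist x y}
      ≤ 2 * θ {z | dist x y < dist x z} + 2 * θ {z | dist x z = dist x y} := by
        gcongr
        exact le_mul_of_one_le_left zero_le one_le_two
    _ = 2 * θ ({z | dist x y < dist x z} ∪ {z | dist x z = dist x y}) := by
        rw [measure_union hdisj hE, mul_add]
    _ ≤ 2 * 1 := by gcongr; exact prob_le_one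
    _ = 2 := mul_one 2

/-- The total mass of `ν ⊗ ν` splits according to which of two samples is nearer to `x`. -/
theorem measure_univ_sq_le_lintegral {S : Type*} [MetricSpace S] [MeasurableSpace S]
    [OpensMeasurableSpace S] (ν : Measure S) [SFinite ν] (x : S) :
    ν Set.univ ^ 2 ≤
      ∫⁻ y, (2 * ν {z | dist x y < dist x z} + ν {z | dist x z = dist x y}) ∂ν := by
  have hP : MeasurableSet {p : S × S | dist x p.1 < dist x p.2} :=
    measurableSet_lt (by fun_prop) (by fun_prop)
  have hQ : MeasurableSet {p : S × S | dist x p.2 < dist x p.1} :=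
    measurableSet_lt (by fun_prop) (by fun_prop)
  have hE : MeasurableSet {p : S × S | dist x p.2 = dist x p.1} :=
    measurableSet_eq_fun (by fun_prop) (by fun_prop)
  have hcover : (Set.univ : Set (S × S)) ⊆
      ({p | dist x p.1 < dist x p.2} ∪ {p | dist x p.2 < dist x p.1}) ∪
        {p | dist x p.2 = dist x p.1} := by
    intro p _
    rcases lt_trichotomy (dist x p.1) (dist x p.2) with h | h | h
    · exact .inl (.inl h)
    · exact .inr h.symm
    · exact .inl (.inr h)
  have hmeas : Measurable fun y => ν {z | dist x y < dist x z} :=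
    measurable_measure_prodMk_left hP
  calc ν Set.univ ^ 2 = ν.prod ν Set.univ := by
        rw [← Set.univ_prod_univ, Measure.prod_prod, sq]
    _ ≤ ν.prod ν {p | dist x p.1 < dist x p.2} + ν.prod ν {p | dist x p.2 < dist x p.1} +
        ν.prod ν {p | dist x p.2 = dist x p.1} :=
      (measure_mono hcover).trans <| (measure_union_le _ _).trans <| by
        gcongr; exact measure_union_le _ _
    _ = (∫⁻ y, ν {z | dist x y < dist x z} ∂ν) + (∫⁻ y, ν {z | dist x y < dist x z} ∂ν) +
        ∫⁻ y, ν {z | dist x z = dist x y} ∂ν := by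
      rw [Measure.prod_apply hP, Measure.prod_apply_symm hQ, Measure.prod_apply hE]
      rfl
    _ = _ := by
      rw [lintegral_add_left (hmeas.const_mul 2), lintegral_const_mul 2 hmeas, two_mul]

theorem stmt_0 {S : Type*} [MetricSpace S] [CompactSpace S] [MeasurableSpace S] [BorelSpace S]
    (θ : Measure S) [IsProbabilityMeasure θ] (x : S) (A : Set S) (hA : MeasurableSet A) :
    θ A ^ 2 ≤ K12 θ x A ∧ K12 θ x A ≤ 2 * θ A := by
  unfold K12
  constructor
  · rw [← Measure.restrict_apply_univ A]
    refine (measure_univ_sq_le_lintegral (θ.restrict A) x).trans (lintegral_mono fun y => ?_)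
    gcongr <;> exact Measure.restrict_le_self
  · calc ∫⁻ y in A, (2 * θ {z | dist x y < dist x z} + θ {z | dist x z = dist x y}) ∂θ
        ≤ ∫⁻ _ in A, 2 ∂θ := lintegral_mono fun y => K12_density_le θ x y
      _ = 2 * θ A := setLIntegral_const A 2
end

section
/- Let S be a compact metric space and θ a Borel probability measure on S. If π is a Borel probability measure on S that is stationary for the kernel K^{θ,1,2}, i.e. π(A) = ∫_S K^{θ,1,2}(x,A) π(dx) for every Borel set A, then θ(A)² ≤ π(A) ≤ 2·θ(A) for every Borel set A; in particular, π and θ are mutually absolutely continuous. -/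
open MeasureTheory
open scoped ENNReal

/-- Among two independent samples of `μ`, counted with `f`-ties split evenly, one is `f`-smaller. -/
lemma lintegral_two_mul_measure_lt_add_measure_eq {S : Type*} [MeasurableSpace S]
    (μ : Measure S) [SFinite μ] {f : S → ℝ} (hf : Measurable f) :
    ∫⁻ y, (2 * μ {z | f y < f z} + μ {z | f z = f y}) ∂μ = μ Set.univ ^ 2 := by
  have hlt : MeasurableSet {p : S × S | f p.1 < f p.2} :=
    measurableSet_lt (hf.comp measurable_fst) (hf.comp measurable_snd)
  have hgt : MeasurableSet {p : S × S | f p.2 < f p.1} :=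
    measurableSet_lt (hf.comp measurable_snd) (hf.comp measurable_fst)
  have heq : MeasurableSet {p : S × S | f p.2 = f p.1} :=
    measurableSet_eq_fun (hf.comp measurable_snd) (hf.comp measurable_fst)
  have hlt_int : ∫⁻ y, μ {z | f y < f z} ∂μ = μ.prod μ {p | f p.1 < f p.2} :=
    (Measure.prod_apply hlt).symm
  have heq_int : ∫⁻ y, μ {z | f z = f y} ∂μ = μ.prod μ {p | f p.2 = f p.1} :=
    (Measure.prod_apply heq).symm
  have hswap : μ.prod μ {p | f p.2 < f p.1} = μ.prod μ {p | f p.1 < f p.2} := by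
    conv_rhs => rw [← Measure.prod_swap, Measure.map_apply measurable_swap hlt]
    rfl
  have hlt_meas : Measurable fun y => μ {z | f y < f z} := measurable_measure_prodMk_left hlt
  rw [lintegral_add_left (hlt_meas.const_mul 2), lintegral_const_mul _ hlt_meas, hlt_int, heq_int,
    two_mul]
  nth_rewrite 2 [← hswap]
  rw [← measure_union _ hgt, ← measure_union _ heq]
  · rw [sq, ← Measure.prod_prod, Set.univ_prod_univ]
    congr 1
    ext p
    have := lt_trichotomy (f p.1) (f p.2)
    simp only [Set.mem_union, Set.mem_ofPred_eq, Set.mem_univ, iff_true]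
    grind
  · rw [Set.disjoint_left]
    simp only [Set.mem_union, Set.mem_ofPred_eq]
    grind
  · rw [Set.disjoint_left]
    simp only [Set.mem_ofPred_eq]
    grind

lemma sq_le_K12 {S : Type*} [MetricSpace S] [MeasurableSpace S] [OpensMeasurableSpace S]
    (θ : Measure S) [SFinite θ] (x : S) (A : Set S) : θ A ^ 2 ≤ K12 θ x A := by
  have h := lintegral_two_mul_measure_lt_add_measure_eq (θ.restrict A)
    (f := fun z => dist x z) (continuous_const.dist continuous_id).measurable
  rw [Measure.restrict_apply_univ] at h
  rw [← h, K12]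
  gcongr <;> exact Measure.restrict_le_self

lemma K12_le_two_mul {S : Type*} [MetricSpace S] [MeasurableSpace S] [OpensMeasurableSpace S]
    (θ : Measure S) [IsProbabilityMeasure θ] (x : S) (A : Set S) : K12 θ x A ≤ 2 * θ A := by
  rw [K12, ← setLIntegral_const]
  refine lintegral_mono fun y => ?_
  have hdist : Measurable fun z => dist x z := (continuous_const.dist continuous_id).measurable
  have heq : MeasurableSet {z | dist x z = dist x y} :=
    measurableSet_eq_fun hdist measurable_const
  have hdisj : Disjoint {z | dist x y < dist x z} {z | dist x z = dist x y} := by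
    rw [Set.disjoint_left]
    intro z hz hz'
    exact hz.ne' hz'
  calc 2 * θ {z | dist x y < dist x z} + θ {z | dist x z = dist x y}
      ≤ 2 * θ {z | dist x y < dist x z} + 2 * θ {z | dist x z = dist x y} := by
        gcongr
        exact le_mul_of_one_le_left zero_le one_le_two
    _ = 2 * θ ({z | dist x y < dist x z} ∪ {z | dist x z = dist x y}) := by
        rw [measure_union hdisj heq, mul_add]
    _ ≤ 2 * 1 := by gcongr; exact prob_le_one
    _ = 2 := mul_one 2

theorem stmt_1 {S : Type*} [MetricSpace S] [CompactSpace S] [MeasurableSpace S] [BorelSpace S]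
    (θ : Measure S) [IsProbabilityMeasure θ] (π : Measure S) [IsProbabilityMeasure π]
    (hstat : ∀ A : Set S, MeasurableSet A → π A = ∫⁻ x, K12 θ x A ∂π) :
    (∀ A : Set S, MeasurableSet A → θ A ^ 2 ≤ π A ∧ π A ≤ 2 * θ A) ∧
      π ≪ θ ∧ θ ≪ π := by
  have hbound : ∀ A : Set S, MeasurableSet A → θ A ^ 2 ≤ π A ∧ π A ≤ 2 * θ A := by
    intro A hA
    rw [hstat A hA]
    constructor
    · calc θ A ^ 2 = ∫⁻ _, θ A ^ 2 ∂π := by simp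
        _ ≤ ∫⁻ x, K12 θ x A ∂π := lintegral_mono fun x => sq_le_K12 θ x A
    · calc ∫⁻ x, K12 θ x A ∂π ≤ ∫⁻ _, 2 * θ A ∂π := lintegral_mono fun x => K12_le_two_mul θ x A
        _ = 2 * θ A := by simp
  refine ⟨hbound, Measure.AbsolutelyContinuous.mk fun A hA h => ?_,
    Measure.AbsolutelyContinuous.mk fun A hA h => ?_⟩
  · simpa [h] using (hbound A hA).2
  · simpa [h] using (hbound A hA).1
end

section
/- Let S be a compact metric space, θ a Borel probability measure on S, and let π be the unique probability measure stationary for K^{θ,1,2}. Then for every Borel probability measure μ on S and every integer t ≥ 1, the total variation distance between μ(K^{θ,1,2})^{2t} (the distribution after 2t steps of the chain started from μ) and π is at most (1/2)^t. -/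
open MeasureTheory
open scoped ENNReal

/-- The kernel `K^{θ,1,2}(x,·)` as a measure (density with respect to `θ`). -/
noncomputable def K12m {S : Type*} [MetricSpace S] [MeasurableSpace S]
    (θ : Measure S) (x : S) : Measure S :=
  θ.withDensity (fun y => 2 * θ {z | dist x y < dist x z} + θ {z | dist x z = dist x y})

/-- One step of the chain applied to an initial distribution: `μ ↦ μK^{θ,1,2}`. -/
noncomputable def stepMu {S : Type*} [MetricSpace S] [MeasurableSpace S]
    (θ : Measure S) (μ : Measure S) : Measure S :=
  μ.bind (K12m θ)

open ProbabilityTheory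

section NearestOfTwo

variable {S : Type*} [MetricSpace S]

/-- The conditional density of stepping from `x` to `y` when the other sample is `z`. -/
noncomputable def nearerWeight (x y z : S) : ℝ≥0∞ :=
  open Classical in
  if dist x y < dist x z then 2 else if dist x z = dist x y then 1 else 0

lemma nearerWeight_add_swap (x y z : S) : nearerWeight x y z + nearerWeight x z y = 2 := by
  unfold nearerWeight
  rcases lt_trichotomy (dist x y) (dist x z) with h | h | h
  · simp [h, h.not_gt, h.ne]
  · simp [h, one_add_one_eq_two]
  · simp [h, h.not_gt, h.ne]

lemma nearerWeight_le_two (x y z : S) : nearerWeight x y z ≤ 2 := by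
  rw [← nearerWeight_add_swap x y z]
  exact le_self_add

variable [MeasurableSpace S] [BorelSpace S] [SecondCountableTopology S]

lemma measurable_nearerWeight :
    Measurable fun p : S × S × S => nearerWeight p.1 p.2.1 p.2.2 := by
  classical
  unfold nearerWeight
  have h1 : Measurable fun p : S × S × S => dist p.1 p.2.1 := by fun_prop
  have h2 : Measurable fun p : S × S × S => dist p.1 p.2.2 := by fun_prop
  convert Measurable.ite (measurableSet_lt h1 h2) measurable_const
    (Measurable.ite (measurableSet_eq_fun h2 h1) (measurable_const (a := (1 : ℝ≥0∞)))
      (measurable_const (a := (0 : ℝ≥0∞)))) using 1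

lemma measurable_nearerWeight_left (x : S) :
    Measurable fun p : S × S => nearerWeight x p.1 p.2 :=
  measurable_nearerWeight.comp (measurable_const.prodMk measurable_id)

variable (θ : Measure S)

/-- The density of `K12m θ x` with respect to `θ`. -/
noncomputable def nearerDensity (x y : S) : ℝ≥0∞ :=
  2 * θ {z | dist x y < dist x z} + θ {z | dist x z = dist x y}

lemma nearerDensity_eq_lintegral (x y : S) :
    nearerDensity θ x y = ∫⁻ z, nearerWeight x y z ∂θ := by
  classical
  have h1 : MeasurableSet {z | dist x y < dist x z} := measurableSet_lt (by fun_prop) (by fun_prop)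
  have h2 : MeasurableSet {z | dist x z = dist x y} :=
    measurableSet_eq_fun (by fun_prop) (by fun_prop)
  have h : ∀ z, nearerWeight x y z = {z | dist x y < dist x z}.indicator (fun _ => 2) z
      + {z | dist x z = dist x y}.indicator (fun _ => 1) z := by
    intro z
    unfold nearerWeight
    rcases lt_trichotomy (dist x y) (dist x z) with h | h | h
    · simp [h, h.ne']
    · simp [h]
    · simp [h.not_gt, h.ne]
  simp_rw [h]
  rw [lintegral_add_left (measurable_const.indicator h1), lintegral_indicator_const h1,
    lintegral_indicator_const h2, one_mul, nearerDensity]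

lemma measurable_nearerDensity [SFinite θ] :
    Measurable fun p : S × S => nearerDensity θ p.1 p.2 := by
  simp_rw [nearerDensity_eq_lintegral]
  exact Measurable.lintegral_prod_right' (f := fun q : (S × S) × S =>
    nearerWeight q.1.1 q.1.2 q.2) (measurable_nearerWeight.comp
      (by fun_prop : Measurable fun q : (S × S) × S => (q.1.1, q.1.2, q.2)))

lemma lintegral_lintegral_mul_nearerWeight [SFinite θ] (x : S) {g : S → ℝ≥0∞} (hg : Measurable g) :
    ∫⁻ y, ∫⁻ z, g y * g z * nearerWeight x y z ∂θ ∂θ = (∫⁻ y, g y ∂θ) ^ 2 := by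
  have hw := measurable_nearerWeight_left x
  have hm : Measurable fun p : S × S => g p.1 * g p.2 * nearerWeight x p.1 p.2 := by fun_prop
  have hswap : ∫⁻ y, ∫⁻ z, g y * g z * nearerWeight x y z ∂θ ∂θ =
      ∫⁻ y, ∫⁻ z, g y * g z * nearerWeight x z y ∂θ ∂θ := by
    rw [lintegral_lintegral_swap hm.aemeasurable]
    simp_rw [mul_comm (g _) (g _)]
  have hsum : 2 * ∫⁻ y, ∫⁻ z, g y * g z * nearerWeight x y z ∂θ ∂θ =
      2 * (∫⁻ y, g y ∂θ) ^ 2 := by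
    rw [two_mul]
    nth_rewrite 2 [hswap]
    rw [← lintegral_add_left hm.lintegral_prod_right']
    have : ∀ y, (∫⁻ z, g y * g z * nearerWeight x y z ∂θ) +
        (∫⁻ z, g y * g z * nearerWeight x z y ∂θ) = g y * (2 * ∫⁻ z, g z ∂θ) := by
      intro y
      have hmy : Measurable fun z => g y * g z * nearerWeight x y z :=
        hm.comp measurable_prodMk_left
      rw [← lintegral_add_left hmy]
      simp_rw [← mul_add, nearerWeight_add_swap, mul_assoc]
      rw [lintegral_const_mul _ (by fun_prop), lintegral_mul_const _ hg, mul_comm _ (2 : ℝ≥0∞)]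
    simp_rw [this]
    rw [lintegral_mul_const _ hg]
    ring
  exact (ENNReal.mul_right_inj (by simp) (by simp)).1 hsum

variable [IsProbabilityMeasure θ]

lemma nearerDensity_le_two (x y : S) : nearerDensity θ x y ≤ 2 := by
  rw [nearerDensity_eq_lintegral]
  calc _ ≤ ∫⁻ _, 2 ∂θ := lintegral_mono fun z => nearerWeight_le_two x y z
    _ = 2 := by simp

lemma lintegral_nearerDensity (x : S) : ∫⁻ y, nearerDensity θ x y ∂θ = 1 := by
  simp_rw [nearerDensity_eq_lintegral]
  simpa using lintegral_lintegral_mul_nearerWeight θ x (g := fun _ => 1) measurable_const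

lemma sq_lintegral_le_two_mul_lintegral_nearerDensity_mul (x : S) {g : S → ℝ≥0∞}
    (hg : Measurable g) (hg2 : ∀ y, g y ≤ 2) :
    (∫⁻ y, g y ∂θ) ^ 2 ≤ 2 * ∫⁻ y, nearerDensity θ x y * g y ∂θ := by
  have hk : Measurable fun y => nearerDensity θ x y :=
    (measurable_nearerDensity θ).comp measurable_prodMk_left
  rw [← lintegral_lintegral_mul_nearerWeight θ x hg, ← lintegral_const_mul _ (by fun_prop)]
  refine lintegral_mono fun y => ?_
  have hw : Measurable fun z => nearerWeight x y z :=
    (measurable_nearerWeight_left x).comp measurable_prodMk_left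
  calc ∫⁻ z, g y * g z * nearerWeight x y z ∂θ
      ≤ ∫⁻ z, g y * 2 * nearerWeight x y z ∂θ := by
        refine lintegral_mono fun z => ?_
        dsimp only
        gcongr
        exact hg2 z
    _ = 2 * (nearerDensity θ x y * g y) := by
        rw [lintegral_const_mul _ hw, nearerDensity_eq_lintegral]
        ring

/-- `K12m θ` as a Markov kernel. -/
noncomputable def nearerKernel : Kernel S S :=
  Kernel.withDensity (Kernel.const S θ) (nearerDensity θ)

lemma nearerKernel_apply (x : S) : nearerKernel θ x = K12m θ x := by
  rw [nearerKernel, Kernel.withDensity_apply _ (measurable_nearerDensity θ), Kernel.const_apply]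
  rfl

lemma coe_nearerKernel : ⇑(nearerKernel θ) = K12m θ := funext (nearerKernel_apply θ)

lemma lintegral_nearerKernel (x : S) {f : S → ℝ≥0∞} (hf : Measurable f) :
    ∫⁻ y, f y ∂(nearerKernel θ x) = ∫⁻ y, nearerDensity θ x y * f y ∂θ := by
  have hk : Measurable fun y => nearerDensity θ x y :=
    (measurable_nearerDensity θ).comp measurable_prodMk_left
  rw [nearerKernel_apply]
  exact lintegral_withDensity_eq_lintegral_mul θ hk hf

instance : IsMarkovKernel (nearerKernel θ) where
  isProbabilityMeasure x := ⟨by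
    rw [← lintegral_one, lintegral_nearerKernel θ x measurable_const]
    simpa using lintegral_nearerDensity θ x⟩

/-- The mean transition density into `z`, when the starting point is drawn from `θ`. -/
noncomputable def meanDensity (z : S) : ℝ≥0∞ := ∫⁻ y, nearerDensity θ y z ∂θ

lemma measurable_meanDensity : Measurable (meanDensity θ) :=
  (measurable_nearerDensity θ).lintegral_prod_left'

lemma lintegral_meanDensity : ∫⁻ z, meanDensity θ z ∂θ = 1 := by
  unfold meanDensity
  rw [lintegral_lintegral_swap (f := fun z y => nearerDensity θ y z)
    ((measurable_nearerDensity θ).comp measurable_swap).aemeasurable]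
  simp [lintegral_nearerDensity]

lemma one_le_lintegral_meanDensity_sq : 1 ≤ ∫⁻ z, meanDensity θ z ^ 2 ∂θ := by
  have hm := measurable_meanDensity θ
  have h : ∫⁻ z, 2 * meanDensity θ z ∂θ ≤ ∫⁻ z, (meanDensity θ z ^ 2 + 1) ∂θ := by
    refine lintegral_mono fun z => ?_
    dsimp only
    generalize meanDensity θ z = a
    induction a with
    | top => simp
    | coe a =>
      norm_cast
      simpa using two_mul_le_add_sq a 1
  rw [lintegral_const_mul _ hm, lintegral_meanDensity, lintegral_add_right _ measurable_const] at h
  simp only [mul_one, lintegral_const, measure_univ] at h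
  rw [← one_add_one_eq_two] at h
  exact (ENNReal.add_le_add_iff_right (by simp)).1 h

/-- A common lower bound for all two-step transition probabilities. -/
noncomputable def minorant : Measure S := θ.withDensity fun z => 2⁻¹ * meanDensity θ z ^ 2

lemma minorant_le_comp (x : S) : minorant θ ≤ (nearerKernel θ ∘ₖ nearerKernel θ) x := by
  have hk := measurable_nearerDensity θ
  refine Measure.le_iff.2 fun A hA => ?_
  have hA' : ∀ y, nearerKernel θ y A = ∫⁻ z in A, nearerDensity θ y z ∂θ := fun y => by
    rw [nearerKernel_apply]
    exact withDensity_apply _ hA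
  rw [Kernel.comp_apply' _ _ _ hA, lintegral_nearerKernel θ x (Kernel.measurable_coe _ hA),
    minorant, withDensity_apply _ hA]
  simp_rw [hA']
  have hpull : ∀ y, nearerDensity θ x y * ∫⁻ z in A, nearerDensity θ y z ∂θ =
      ∫⁻ z in A, nearerDensity θ x y * nearerDensity θ y z ∂θ := fun y =>
    (lintegral_const_mul _ (hk.comp measurable_prodMk_left)).symm
  simp_rw [hpull]
  rw [lintegral_lintegral_swap (Measurable.aemeasurable
    ((hk.comp (measurable_const.prodMk measurable_fst)).mul hk))]
  refine lintegral_mono fun z => ?_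
  have := sq_lintegral_le_two_mul_lintegral_nearerDensity_mul θ x (g := fun y => nearerDensity θ y z)
    (hk.comp measurable_prodMk_right) fun y => nearerDensity_le_two θ y z
  exact (ENNReal.inv_mul_le_iff (by simp) (by simp)).2 this

lemma half_le_minorant_univ : 2⁻¹ ≤ minorant θ Set.univ := by
  rw [minorant, withDensity_apply _ MeasurableSet.univ, Measure.restrict_univ,
    lintegral_const_mul _ ((measurable_meanDensity θ).pow_const 2)]
  simpa using mul_le_mul_right (one_le_lintegral_meanDensity_sq θ) (2⁻¹ : ℝ≥0∞)

end NearestOfTwo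

section Minorization

variable {S : Type*} [MeasurableSpace S]

lemma integrable_of_forall_mem_Icc {ν : Measure S} [IsFiniteMeasure ν] {f : S → ℝ}
    (hf : Measurable f) {a b : ℝ} (hab : ∀ x, f x ∈ Set.Icc a b) : Integrable f ν :=
  Integrable.of_mem_Icc a b hf.aemeasurable (ae_of_all _ hab)

lemma integral_kernel_mem_Icc_of_minorant (P : Kernel S S) [IsMarkovKernel P] {ρ : Measure S}
    (hρ : ∀ x, ρ ≤ P x) [IsFiniteMeasure ρ] {f : S → ℝ} (hf : Measurable f) {a b : ℝ}
    (hab : ∀ x, f x ∈ Set.Icc a b) (x : S) :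
    ∫ y, f y ∂(P x) ∈ Set.Icc (a + ((∫ y, f y ∂ρ) - a * ρ.real Set.univ))
      (b - (b * ρ.real Set.univ - ∫ y, f y ∂ρ)) := by
  have hi {ν : Measure S} [IsFiniteMeasure ν] : Integrable f ν := integrable_of_forall_mem_Icc hf hab
  have ha := integral_mono_measure (hρ x) (f := fun y => f y - a)
    (ae_of_all _ fun y => sub_nonneg.2 (hab y).1) (hi.sub (integrable_const a))
  have hb := integral_mono_measure (hρ x) (f := fun y => b - f y)
    (ae_of_all _ fun y => sub_nonneg.2 (hab y).2) ((integrable_const b).sub hi)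
  rw [integral_sub hi (integrable_const a), integral_sub hi (integrable_const a)] at ha
  rw [integral_sub (integrable_const b) hi, integral_sub (integrable_const b) hi] at hb
  simp only [integral_const, probReal_univ, smul_eq_mul, one_mul] at ha hb
  constructor <;> linarith

lemma abs_integral_iterate_sub_le (P : Kernel S S) [IsMarkovKernel P] {ρ : Measure S}
    (hρ : ∀ x, ρ ≤ P x) [IsFiniteMeasure ρ] (hρ2 : 1 / 2 ≤ ρ.real Set.univ)
    (t : ℕ) : ∀ (μ ν : Measure S) [IsProbabilityMeasure μ] [IsProbabilityMeasure ν] {f : S → ℝ},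
    Measurable f → ∀ {a b : ℝ}, (∀ x, f x ∈ Set.Icc a b) →
    |∫ x, f x ∂((fun m : Measure S => P ∘ₘ m)^[t] μ) -
      ∫ x, f x ∂((fun m : Measure S => P ∘ₘ m)^[t] ν)| ≤ (b - a) * (1 / 2) ^ t := by
  induction t with
  | zero =>
    intro μ ν _ _ f hf a b hab
    have hmem (m : Measure S) [IsProbabilityMeasure m] : ∫ x, f x ∂m ∈ Set.Icc a b := by
      have hi : Integrable f m := integrable_of_forall_mem_Icc hf hab
      have h1 := integral_mono (integrable_const a) hi fun x => (hab x).1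
      have h2 := integral_mono hi (integrable_const b) fun x => (hab x).2
      simp only [integral_const, probReal_univ, smul_eq_mul, one_mul] at h1 h2
      exact ⟨h1, h2⟩
    simp only [Function.iterate_zero, id_eq, pow_zero, mul_one]
    exact Real.dist_le_of_mem_Icc (hmem μ) (hmem ν)
  | succ t ih =>
    intro μ ν _ _ f hf a b hab
    have hprob (m : Measure S) [IsProbabilityMeasure m] :
        IsProbabilityMeasure ((fun m : Measure S => P ∘ₘ m)^[t] m) := by
      clear ih
      induction t with
      | zero => simpa
      | succ t ih => rw [Function.iterate_succ_apply']; infer_instance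
    have hstep (m : Measure S) [IsProbabilityMeasure m] :
        ∫ x, f x ∂((fun m : Measure S => P ∘ₘ m)^[t + 1] m) =
          ∫ x, ∫ y, f y ∂(P x) ∂((fun m : Measure S => P ∘ₘ m)^[t] m) := by
      have := hprob m
      rw [Function.iterate_succ_apply']
      exact Kernel.integral_comp (η := P) (κ := Kernel.const Unit _) (a := ())
        (integrable_of_forall_mem_Icc hf hab)
    rw [hstep μ, hstep ν]
    refine (ih μ ν hf.stronglyMeasurable.integral_kernel.measurable
      (integral_kernel_mem_Icc_of_minorant P hρ hf hab)).trans ?_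
    have hba : a ≤ b := by
      obtain ⟨x⟩ := nonempty_of_isProbabilityMeasure μ
      exact (hab x).1.trans (hab x).2
    have : (0 : ℝ) ≤ (1 / 2) ^ t := by positivity
    rw [pow_succ', ← mul_assoc]
    refine mul_le_mul_of_nonneg_right ?_ this
    nlinarith

end Minorization

theorem stmt_4 {S : Type*} [MetricSpace S] [CompactSpace S] [MeasurableSpace S] [BorelSpace S]
    (θ : Measure S) [IsProbabilityMeasure θ] (π : Measure S) [IsProbabilityMeasure π]
    (hstat : ∀ A : Set S, MeasurableSet A → π A = ∫⁻ x, K12 θ x A ∂π)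
    (μ : Measure S) [IsProbabilityMeasure μ] (t : ℕ) (ht : 1 ≤ t) :
    ∀ B : Set S, MeasurableSet B →
      |(((stepMu θ)^[2 * t] μ) B).toReal - (π B).toReal| ≤ (1 / 2 : ℝ) ^ t := by
  intro B hB
  have hstep : stepMu θ = fun m => nearerKernel θ ∘ₘ m := by
    funext m
    rw [stepMu, coe_nearerKernel]
  have hπ : stepMu θ π = π := by
    rw [hstep]
    refine Measure.ext fun A hA => ?_
    rw [Measure.bind_apply hA (Kernel.aemeasurable _), hstat A hA]
    refine lintegral_congr fun x => ?_
    rw [nearerKernel_apply, K12m, withDensity_apply _ hA, K12]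
  have htwo : (stepMu θ)^[2 * t] =
      (fun m => (nearerKernel θ ∘ₖ nearerKernel θ) ∘ₘ m)^[t] := by
    rw [Function.iterate_mul]
    congr 1
    funext m
    simp [hstep, Measure.comp_assoc]
  have hfin : IsFiniteMeasure (minorant θ) := by
    obtain ⟨x⟩ := nonempty_of_isProbabilityMeasure μ
    exact isFiniteMeasure_of_le _ (minorant_le_comp θ x)
  have hhalf : 1 / 2 ≤ (minorant θ).real Set.univ := by
    have := ENNReal.toReal_mono (measure_ne_top _ _) (half_le_minorant_univ θ)
    simpa [Measure.real] using this
  have key := abs_integral_iterate_sub_le (nearerKernel θ ∘ₖ nearerKernel θ) (minorant_le_comp θ)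
    hhalf t μ π (f := B.indicator 1) (measurable_one.indicator hB) (a := 0) (b := 1) fun x => by
      by_cases hx : x ∈ B <;> simp [hx]
  rw [← htwo, Function.iterate_fixed hπ, integral_indicator_one hB, integral_indicator_one hB] at key
  simpa [Measure.real] using key
end

section
/- Let S be a compact metric space and s₁ ≠ s₂ two points of S. The uniform two-point measure θ = (δ_{s₁} + δ_{s₂})/2 is both π_{1,2}-invariant and π_{2,2}-invariant: θ(A) = ∫_S K^{θ,1,2}(x,A) θ(dx) and θ(A) = ∫_S K^{θ,2,2}(x,A) θ(dx) for every Borel set A ⊆ S. -/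
open MeasureTheory
open scoped ENNReal

/-- The transition kernel `K^{θ,2,2}(x,A)`: step to the farther of two i.i.d. `θ`-samples,
ties broken uniformly. -/
noncomputable def K22 {S : Type*} [MetricSpace S] [MeasurableSpace S]
    (θ : Measure S) (x : S) (A : Set S) : ℝ≥0∞ :=
  ∫⁻ y in A, (2 * θ {z | dist x z < dist x y} + θ {z | dist x z = dist x y}) ∂θ

/-- The uniform measure on two points is invariant under the density kernel `w` as soon as the
columns of `w` at these two points sum to `2`. -/
theorem measure_eq_lintegral_setLIntegral_of_two_point {S : Type*} [MeasurableSpace S]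
    [MeasurableSingletonClass S] (s₁ s₂ : S) (w : S → S → ℝ≥0∞)
    (h₁ : w s₁ s₁ + w s₂ s₁ = 2) (h₂ : w s₁ s₂ + w s₂ s₂ = 2)
    (θ : Measure S) (hθ : θ = (2 : ℝ≥0∞)⁻¹ • (Measure.dirac s₁ + Measure.dirac s₂))
    {A : Set S} (hA : MeasurableSet A) :
    θ A = ∫⁻ x, ∫⁻ y in A, w x y ∂θ ∂θ := by
  have lint (f : S → ℝ≥0∞) : ∫⁻ x, f x ∂θ = 2⁻¹ * (f s₁ + f s₂) := by
    simp [hθ, mul_add]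
  have inv_mul_two : (2 : ℝ≥0∞)⁻¹ * 2 = 1 := ENNReal.inv_mul_cancel (by simp) (by simp)
  have split (s : S) (h : w s₁ s + w s₂ s = 2) :
      A.indicator (w s₁) s + A.indicator (w s₂) s = 2 * A.indicator 1 s := by
    by_cases hsA : s ∈ A <;> simp [hsA, h]
  simp_rw [← lintegral_indicator hA, lint]
  calc θ A = 2⁻¹ * (A.indicator 1 s₁ + A.indicator 1 s₂) := by simp [hθ, mul_add]
    _ = 2⁻¹ * (2⁻¹ * 2 * (A.indicator 1 s₁ + A.indicator 1 s₂)) := by rw [inv_mul_two, one_mul]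
    _ = 2⁻¹ * (2⁻¹ * (2 * A.indicator 1 s₁ + 2 * A.indicator 1 s₂)) := by ring
    _ = 2⁻¹ * (2⁻¹ * (A.indicator (w s₁) s₁ + A.indicator (w s₁) s₂) +
          2⁻¹ * (A.indicator (w s₂) s₁ + A.indicator (w s₂) s₂)) := by
      rw [← split s₁ h₁, ← split s₂ h₂]
      ring

theorem stmt_7 {S : Type*} [MetricSpace S] [CompactSpace S] [MeasurableSpace S] [BorelSpace S]
    (s₁ s₂ : S) (hne : s₁ ≠ s₂)
    (θ : Measure S) (hθ : θ = (2 : ℝ≥0∞)⁻¹ • (Measure.dirac s₁ + Measure.dirac s₂)) :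
    (∀ A : Set S, MeasurableSet A → θ A = ∫⁻ x, K12 θ x A ∂θ) ∧
      (∀ A : Set S, MeasurableSet A → θ A = ∫⁻ x, K22 θ x A ∂θ) := by
  have half_sum : (2 : ℝ≥0∞) * 2⁻¹ + 2⁻¹ + 2⁻¹ = 2 := by
    rw [add_assoc, ENNReal.inv_two_add_inv_two, ENNReal.mul_inv_cancel (by simp) (by simp),
      one_add_one_eq_two]
  have hd : 0 < dist s₁ s₂ := dist_pos.2 hne
  have θ_apply (B : Set S) : θ B = 2⁻¹ * (B.indicator 1 s₁ + B.indicator 1 s₂) := by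
    simp [hθ, mul_add]
  refine ⟨fun A hA => ?_, fun A hA => ?_⟩
  all_goals
    refine measure_eq_lintegral_setLIntegral_of_two_point s₁ s₂ _ ?_ ?_ θ hθ hA <;>
    simp only [θ_apply] <;>
    simp [dist_comm s₂ s₁, hne, hne.symm, hd, hd.ne, hd.not_gt, half_sum,
      add_comm (2⁻¹ : ℝ≥0∞) (2 * 2⁻¹ + 2⁻¹)]
end

section
/- Let S be a compact metric space and θ a π_{1,2}-invariant Borel probability measure on S. Then for θ-almost every y ∈ S, ∫_S ∫_S 1{d(x,z) > d(x,y)} θ(dz) θ(dx) = ∫_S ∫_S 1{d(x,z) < d(x,y)} θ(dz) θ(dx). -/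
open MeasureTheory
open scoped ENNReal

theorem measurable_measure_dist_lt {S : Type*} [PseudoMetricSpace S] [SecondCountableTopology S]
    [MeasurableSpace S] [BorelSpace S] (θ : Measure S) [SFinite θ] :
    Measurable fun p : S × S => θ {z | dist p.1 p.2 < dist p.1 z} :=
  measurable_measure_prodMk_left (ν := θ)
    (s := {q : (S × S) × S | dist q.1.1 q.1.2 < dist q.1.1 q.2})
    (measurableSet_lt (by fun_prop) (by fun_prop))

theorem measurable_measure_dist_eq {S : Type*} [PseudoMetricSpace S] [SecondCountableTopology S]
    [MeasurableSpace S] [BorelSpace S] (θ : Measure S) [SFinite θ] :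
    Measurable fun p : S × S => θ {z | dist p.1 z = dist p.1 p.2} :=
  measurable_measure_prodMk_left (ν := θ)
    (s := {q : (S × S) × S | dist q.1.1 q.2 = dist q.1.1 q.1.2})
    (measurableSet_eq_fun (by fun_prop) (by fun_prop))

theorem measure_lt_add_eq_add_gt {Ω : Type*} [MeasurableSpace Ω] (μ : Measure Ω)
    [IsProbabilityMeasure μ] {f : Ω → ℝ} (hf : Measurable f) (r : ℝ) :
    μ {z | r < f z} + μ {z | f z = r} + μ {z | f z < r} = 1 := by
  have hgt : {z | r < f z} ∪ {z | f z = r} = {z | f z < r}ᶜ := by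
    ext z
    simp [le_iff_lt_or_eq, eq_comm]
  have hdisj : Disjoint {z | r < f z} {z | f z = r} :=
    Set.disjoint_left.2 fun z hz hz' => (ne_of_gt hz) hz'
  rw [← measure_union hdisj (hf (measurableSet_singleton r)), hgt, add_comm]
  exact prob_add_prob_compl (measurableSet_lt hf measurable_const)

theorem stmt_9 {S : Type*} [MetricSpace S] [CompactSpace S] [MeasurableSpace S] [BorelSpace S]
    (θ : Measure S) [IsProbabilityMeasure θ]
    (hinv : ∀ A : Set S, MeasurableSet A → θ A = ∫⁻ x, K12 θ x A ∂θ) :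
    ∀ᵐ y ∂θ,
      (∫⁻ x, ∫⁻ z, Set.indicator {z | dist x y < dist x z} (fun _ => (1 : ℝ≥0∞)) z ∂θ ∂θ) =
        ∫⁻ x, ∫⁻ z, Set.indicator {z | dist x z < dist x y} (fun _ => (1 : ℝ≥0∞)) z ∂θ ∂θ := by
  have hG := measurable_measure_dist_lt θ
  have hE := measurable_measure_dist_eq θ
  have hK : Measurable fun p : S × S =>
      2 * θ {z | dist p.1 p.2 < dist p.1 z} + θ {z | dist p.1 z = dist p.1 p.2} :=
    (hG.const_mul 2).add hE
  have hone : ∀ᵐ y ∂θ,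
      (∫⁻ x, (2 * θ {z | dist x y < dist x z} + θ {z | dist x z = dist x y}) ∂θ) = 1 := by
    refine ae_eq_of_forall_setLIntegral_eq_of_sigmaFinite hK.lintegral_prod_left'
      measurable_const fun A hA _ => ?_
    rw [setLIntegral_one, hinv A hA]
    exact lintegral_lintegral_swap (f := fun y x =>
      2 * θ {z | dist x y < dist x z} + θ {z | dist x z = dist x y})
      (hK.comp measurable_swap).aemeasurable
  filter_upwards [hone] with y hy
  have hy' : Measurable fun x : S => (x, y) := measurable_prodMk_right
  have hGy : Measurable fun x => θ {z | dist x y < dist x z} := hG.comp hy'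
  have hEy : Measurable fun x => θ {z | dist x z = dist x y} := hE.comp hy'
  have hind (x : S) :
      (∫⁻ z, Set.indicator {z | dist x y < dist x z} (fun _ => (1 : ℝ≥0∞)) z ∂θ)
        = θ {z | dist x y < dist x z} :=
    lintegral_indicator_one (measurableSet_lt (by fun_prop) (by fun_prop))
  have hind' (x : S) :
      (∫⁻ z, Set.indicator {z | dist x z < dist x y} (fun _ => (1 : ℝ≥0∞)) z ∂θ)
        = θ {z | dist x z < dist x y} :=
    lintegral_indicator_one (measurableSet_lt (by fun_prop) (by fun_prop))
  simp only [hind, hind']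
  have htot : (∫⁻ x, (θ {z | dist x y < dist x z} + θ {z | dist x z = dist x y}
      + θ {z | dist x z < dist x y}) ∂θ) = 1 := by
    rw [← measure_univ (μ := θ), ← lintegral_one]
    exact lintegral_congr fun x =>
      measure_lt_add_eq_add_gt θ (measurable_const.dist measurable_id) (dist x y)
  rw [lintegral_add_left (hGy.fun_add hEy), lintegral_add_left hGy] at htot
  rw [lintegral_add_left (hGy.const_mul 2), lintegral_const_mul 2 hGy, two_mul, add_right_comm,
    ← htot] at hy
  refine (ENNReal.add_right_inj fun htop => ?_).1 hy
  simp [htop] at htot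
end

section
/- Let S = {a,b,c} be a metric space with exactly three points satisfying d(a,b) < d(a,c) < d(b,c). Every π_{1,2}-invariant probability measure θ on S is either a point mass δ_s for some s ∈ S, or the uniform measure (δ_{s₁} + δ_{s₂})/2 on some two-element subset {s₁,s₂} ⊆ S. -/
open MeasureTheory
open scoped ENNReal

theorem finite_of_forall_eq_or_eq_or_eq {α : Type*} {a b c : α}
    (huniv : ∀ s : α, s = a ∨ s = b ∨ s = c) : Finite α :=
  Set.finite_univ_iff.1 (((Set.finite_singleton c).insert b |>.insert a).subset
    fun s _ => by simpa using huniv s)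

/-- A measure on a three-point space is the sum of its weighted point masses. -/
theorem measure_eq_sum_smul_dirac_of_three {S : Type*} [MeasurableSpace S]
    [MeasurableSingletonClass S] {a b c : S} (huniv : ∀ s : S, s = a ∨ s = b ∨ s = c)
    (hab : a ≠ b) (hac : a ≠ c) (hbc : b ≠ c) (θ : Measure S) :
    θ = θ {a} • Measure.dirac a + θ {b} • Measure.dirac b + θ {c} • Measure.dirac c := by
  have := finite_of_forall_eq_or_eq_or_eq huniv
  refine Measure.ext_of_singleton fun s => ?_
  rcases huniv s with rfl | rfl | rfl <;>
    simp [hab, hac, hbc, hab.symm, hac.symm, hbc.symm]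

theorem K12_singleton {S : Type*} [MetricSpace S] [MeasurableSpace S]
    [MeasurableSingletonClass S] (θ : Measure S) (x y : S) :
    K12 θ x {y} =
      (2 * θ {z | dist x y < dist x z} + θ {z | dist x z = dist x y}) * θ {y} := by
  rw [K12, lintegral_singleton]

/-- The nonnegative fixed points of total mass one of the induced map on weights `(p, q, r)`. -/
theorem weights_of_fixed_point {p q r : ℝ} (hp0 : 0 ≤ p) (hq0 : 0 ≤ q)
    (hsum : p + q + r = 1)
    (hp : p = p * (p * (2 * (q + r) + p)) + q * (p * (2 * r + p)) + r * (p * (2 * q + p)))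
    (hr : r = p * (r * r) + q * (r * r) + r * (r * (2 * (p + q) + r))) :
    (p = 1 ∧ q = 0 ∧ r = 0) ∨ (p = 0 ∧ q = 1 ∧ r = 0) ∨ (p = 0 ∧ q = 0 ∧ r = 1) ∨
      (p = 1 / 2 ∧ q = 1 / 2 ∧ r = 0) ∨ (p = 1 / 2 ∧ q = 0 ∧ r = 1 / 2) ∨
        (p = 0 ∧ q = 1 / 2 ∧ r = 1 / 2) := by
  obtain rfl : q = 1 - p - r := by linarith
  have hr' : r * ((2 * r - 1) * (r - 1)) = 0 := by linear_combination hr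
  rcases mul_eq_zero.1 hr' with rfl | h
  · have hp' : p * ((2 * p - 1) * (p - 1)) = 0 := by linear_combination hp
    grind
  rcases mul_eq_zero.1 h with h | h
  · obtain rfl : r = 1 / 2 := by linarith
    have hp' : p * (p * (2 * p - 1)) = 0 := by linear_combination hp
    grind
  · grind

theorem stmt_10 {S : Type*} [MetricSpace S] [MeasurableSpace S] [BorelSpace S]
    (a b c : S) (huniv : ∀ s : S, s = a ∨ s = b ∨ s = c)
    (hab : a ≠ b) (hac : a ≠ c) (hbc : b ≠ c)
    (hd1 : dist a b < dist a c) (hd2 : dist a c < dist b c)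
    (θ : Measure S) [IsProbabilityMeasure θ]
    (hinv : ∀ A : Set S, MeasurableSet A → θ A = ∫⁻ x, K12 θ x A ∂θ) :
    (∃ s : S, θ = Measure.dirac s) ∨
      (∃ s₁ s₂ : S, s₁ ≠ s₂ ∧
        θ = (2 : ℝ≥0∞)⁻¹ • (Measure.dirac s₁ + Measure.dirac s₂)) := by
  have hθ := measure_eq_sum_smul_dirac_of_three huniv hab hac hbc θ
  have hnn (x y : S) : ¬dist x y < 0 := dist_nonneg.not_gt
  have hba : dist b a = dist a b := dist_comm b a
  have hca : dist c a = dist a c := dist_comm c a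
  have hcb : dist c b = dist b c := dist_comm c b
  obtain ⟨p, hp⟩ : ∃ p, θ {a} = p := ⟨_, rfl⟩
  obtain ⟨q, hq⟩ : ∃ q, θ {b} = q := ⟨_, rfl⟩
  obtain ⟨r, hr⟩ : ∃ r, θ {c} = r := ⟨_, rfl⟩
  have hpt : p ≠ ∞ := hp ▸ measure_ne_top θ _
  have hqt : q ≠ ∞ := hq ▸ measure_ne_top θ _
  have hrt : r ≠ ∞ := hr ▸ measure_ne_top θ _
  rw [hp, hq, hr] at hθ
  have hset (A : Set S) :
      θ A = p * A.indicator 1 a + q * A.indicator 1 b + r * A.indicator 1 c := by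
    have := finite_of_forall_eq_or_eq_or_eq huniv
    rw [hθ]
    simp
  have hint (f : S → ℝ≥0∞) : ∫⁻ x, f x ∂θ = p * f a + q * f b + r * f c := by
    rw [hθ]
    simp [lintegral_add_measure]
  have hsum : p + q + r = 1 := by simpa using (hset Set.univ).symm
  have hltc : dist a b < dist b c := hd1.trans hd2
  have eqa := hinv {a} (measurableSet_singleton a)
  have eqc := hinv {c} (measurableSet_singleton c)
  rw [hint] at eqa eqc
  simp only [K12_singleton, hp, hr] at eqa eqc
  simp [hset, Set.indicator, hba, hca, hcb, hd2, hltc, hd1.ne, hltc.ne, hd2.ne', hltc.ne',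
    hd1.not_gt, hltc.not_gt, hnn, hab, hac, hbc, hab.symm,
    hac.symm, hbc.symm] at eqa eqc
  lift p to NNReal using hpt
  lift q to NNReal using hqt
  lift r to NNReal using hrt
  norm_cast at hsum eqa eqc
  have hsum' : (p + q + r : ℝ) = 1 := mod_cast hsum
  have eqa' := congrArg NNReal.toReal eqa
  have eqc' := congrArg NNReal.toReal eqc
  push_cast at eqa' eqc'
  have := weights_of_fixed_point p.coe_nonneg q.coe_nonneg hsum'
    (by linear_combination eqa') (by linear_combination eqc')
  have h2 (u : NNReal) (h : (u : ℝ) = 1 / 2) : (u : ℝ≥0∞) = 2⁻¹ := by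
    obtain rfl : u = 2⁻¹ := NNReal.coe_injective (by simpa using h)
    simp
  have h1 (u : NNReal) (h : (u : ℝ) = 1) : (u : ℝ≥0∞) = 1 := mod_cast h
  have h0 (u : NNReal) (h : (u : ℝ) = 0) : (u : ℝ≥0∞) = 0 := mod_cast h
  rcases this with ⟨hp, hq, hr⟩ | ⟨hp, hq, hr⟩ | ⟨hp, hq, hr⟩ | ⟨hp, hq, hr⟩ | ⟨hp, hq, hr⟩ |
    ⟨hp, hq, hr⟩
  · exact .inl ⟨a, by simpa [h1 p hp, h0 q hq, h0 r hr] using hθ⟩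
  · exact .inl ⟨b, by simpa [h0 p hp, h1 q hq, h0 r hr] using hθ⟩
  · exact .inl ⟨c, by simpa [h0 p hp, h0 q hq, h1 r hr] using hθ⟩
  · exact .inr ⟨a, b, hab, by simpa [h2 p hp, h2 q hq, h0 r hr] using hθ⟩
  · exact .inr ⟨a, c, hac, by simpa [h2 p hp, h0 q hq, h2 r hr] using hθ⟩
  · exact .inr ⟨b, c, hbc, by simpa [h0 p hp, h2 q hq, h2 r hr] using hθ⟩
end

section
/- Let θ be a π_{2,2}-invariant Borel probability measure on the interval [0,1] (with the Euclidean metric d(x,y) = |x−y|). Then θ is either a point mass δ_s for some s ∈ [0,1], or a uniform two-point measure (δ_{s₁} + δ_{s₂})/2 for some s₁ ≠ s₂ in [0,1]. -/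
open MeasureTheory
open scoped ENNReal

open Filter Topology

/-- The Fatou lemma, phrased as lower semicontinuity of an integral in a parameter. -/
theorem lowerSemicontinuous_lintegral {X Y : Type*} [TopologicalSpace Y]
    [FirstCountableTopology Y] [MeasurableSpace X] {μ : Measure X} {f : Y → X → ℝ≥0∞}
    (hf : ∀ y, Measurable (f y)) (hlsc : ∀ x, LowerSemicontinuous fun y => f y x) :
    LowerSemicontinuous fun y => ∫⁻ x, f y x ∂μ := by
  rw [lowerSemicontinuous_iff_le_liminf]
  intro y
  refine le_trans (lintegral_mono fun x => ?_) (lintegral_liminf_le (u := 𝓝 y) hf)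
  exact lowerSemicontinuous_iff_le_liminf.1 (hlsc x) y

theorem one_sub_real_le_of_ae {S : Type*} [MeasurableSpace S] {θ : Measure S}
    [IsProbabilityMeasure θ] {A B : Set S} (h : ∀ᵐ z ∂θ, z ∉ A → z ∈ B) :
    1 - θ.real A ≤ θ.real B := by
  have h1 : θ.real Set.univ ≤ θ.real (A ∪ B) := by
    refine ENNReal.toReal_mono (measure_ne_top _ _) (measure_mono_ae ?_)
    filter_upwards [h] with z hz _
    by_cases hA : z ∈ A
    · exact Or.inl hA
    · exact Or.inr (hz hA)
  have h2 := measureReal_union_le (μ := θ) A B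
  simp only [probReal_univ] at h1
  linarith

/-- The arithmetic core: `A`, `B` are the masses of the two extreme points and `p`, `q`, `r` the
masses of the regions where the first one is farther, nearer, or equally far. -/
theorem two_atom_arithmetic {p q r A B e e' : ℝ} (hsum : p + q + r = 1) (hp : 0 < p)
    (hq : 0 < q) (hr : 0 ≤ r) (hA : 0 ≤ A) (hB : 0 ≤ B) (hAq : A ≤ q) (hBp : B ≤ p)
    (he : 0 ≤ e) (he' : 0 ≤ e') (hea : e = 0 → q ≤ A) (heb : e' = 0 → p ≤ B)
    (ha₁ : 2 * (1 - A) * p + e + 2 * (1 - A - B) * r ≤ 1)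
    (ha₂ : 0 < A → (2 - A) * p + A * q + e + (2 - A - B) * r ≤ 1)
    (hb₁ : 2 * (1 - B) * q + e' + 2 * (1 - B - A) * r ≤ 1)
    (hb₂ : 0 < B → (2 - B) * q + B * p + e' + (2 - B - A) * r ≤ 1) :
    A = 1 / 2 ∧ B = 1 / 2 := by
  have ha : 0 < A → (1 - A) * (p - q + r) + e ≤ r * B := fun h => by
    obtain rfl : r = 1 - p - q := by linarith
    linarith [ha₂ h]
  have hb : 0 < B → (1 - B) * (q - p + r) + e' ≤ r * A := fun h => by
    obtain rfl : r = 1 - p - q := by linarith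
    linarith [hb₂ h]
  have hr0 : r = 0 := by
    by_contra hne
    have hrpos : 0 < r := lt_of_le_of_ne hr (Ne.symm hne)
    have hC : 0 < 1 - A - B := by linarith
    have hCr : 0 < (1 - A - B) * r := mul_pos hC hrpos
    rcases hA.eq_or_lt with rfl | hA' <;> rcases hB.eq_or_lt with rfl | hB'
    · linarith
    · have := hb hB'
      have : q - p + r ≤ 0 := by
        by_contra! h
        nlinarith [mul_pos (show 0 < 1 - B by linarith) h]
      linarith
    · have := ha hA'
      have : p - q + r ≤ 0 := by
        by_contra! h
        nlinarith [mul_pos (show 0 < 1 - A by linarith) h]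
      linarith
    · have h1 : p - q < 0 := by
        by_contra! h
        nlinarith [ha hA', mul_nonneg (show 0 ≤ 1 - A by linarith) h]
      have h2 : q - p < 0 := by
        by_contra! h
        nlinarith [hb hB', mul_nonneg (show 0 ≤ 1 - B by linarith) h]
      linarith
  subst hr0
  have hpq : p ≤ q := by
    rcases hA.eq_or_lt with rfl | hA'
    · linarith
    · by_contra! h
      nlinarith [ha hA', mul_pos (show 0 < 1 - A by linarith) (sub_pos.2 h)]
  have hqp : q ≤ p := by
    rcases hB.eq_or_lt with rfl | hB'
    · linarith
    · by_contra! h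
      nlinarith [hb hB', mul_pos (show 0 < 1 - B by linarith) (sub_pos.2 h)]
  obtain rfl : p = q := le_antisymm hpq hqp
  have he0 : e = 0 := by
    rcases hA.eq_or_lt with rfl | hA'
    · linarith
    · linarith [ha hA']
  have he0' : e' = 0 := by
    rcases hB.eq_or_lt with rfl | hB'
    · linarith
    · linarith [hb hB']
  constructor <;> linarith [hea he0, heb he0']

section Metric

variable {S : Type*} [MetricSpace S] [MeasurableSpace S] [BorelSpace S] {θ : Measure S}

theorem lowerSemicontinuous_measure_dist_lt (x : S) :
    LowerSemicontinuous fun y => θ {z | dist x z < dist x y} := by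
  have h : ∀ y, θ {z | dist x z < dist x y} =
      ∫⁻ z, {y | dist x z < dist x y}.indicator (fun _ => (1 : ℝ≥0∞)) y ∂θ := fun y => by
    rw [← lintegral_indicator_one (isOpen_lt (by fun_prop) (by fun_prop)).measurableSet]
    rfl
  simp_rw [h]
  refine lowerSemicontinuous_lintegral (fun y => ?_) fun z => ?_
  · exact measurable_const.indicator
      (isOpen_lt (f := fun z => dist x z) (g := fun _ => dist x y)
        (by fun_prop) (by fun_prop)).measurableSet
  · exact (isOpen_lt (by fun_prop) (by fun_prop)).lowerSemicontinuous_indicator zero_le_one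

/-- The three-way split of `S` according to which of `a`, `b` is farther. -/
theorem lintegral_farther_split (a b : S) (f : S → ℝ≥0∞) :
    ∫⁻ x, f x ∂θ = ∫⁻ x in {x | dist x b < dist x a}, f x ∂θ +
      (∫⁻ x in {x | dist x a < dist x b}, f x ∂θ +
        ∫⁻ x in {x | dist x a = dist x b}, f x ∂θ) := by
  have hQ : MeasurableSet {x : S | dist x a < dist x b} :=
    (isOpen_lt (by fun_prop) (by fun_prop)).measurableSet
  have hP : MeasurableSet {x : S | dist x b < dist x a} :=
    (isOpen_lt (by fun_prop) (by fun_prop)).measurableSet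
  have hR : MeasurableSet {x : S | dist x a = dist x b} :=
    (isClosed_eq (by fun_prop) (by fun_prop)).measurableSet
  rw [← lintegral_union hR, ← lintegral_union (hQ.union hR), ← setLIntegral_univ]
  · congr 2
    ext x
    simp only [Set.mem_univ, Set.mem_union, Set.mem_ofPred_eq, true_iff]
    rcases lt_trichotomy (dist x a) (dist x b) with h | h | h <;> simp [h]
  · refine Set.disjoint_left.2 fun x h h' => ?_
    rcases h' with h' | h' <;> simp only [Set.mem_ofPred_eq] at h h' <;> linarith
  · exact Set.disjoint_left.2 fun x hlt heq => (show dist x a < dist x b from hlt).ne heq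

/-- Lower bound for the mean of a weight in terms of its values on the three pieces on which
`a` is farther than, nearer than, or as far as `b`. -/
theorem farther_pieces_le_one [IsFiniteMeasure θ] {a b : S} {f W : S → ℝ≥0∞}
    {u v w : ℝ}
    (hu : 0 ≤ u) (hv : 0 ≤ v) (hw : 0 ≤ w) (hW : Measurable W)
    (hf : ∫⁻ x, f x ∂θ ≤ 1)
    (hP : ∀ x, dist x b < dist x a → ENNReal.ofReal u ≤ f x)
    (hQ : ∀ x, dist x a < dist x b → 2 * W x + ENNReal.ofReal v ≤ f x)
    (hR : ∀ x, dist x a = dist x b → ENNReal.ofReal w ≤ f x) :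
    u * θ.real {x | dist x b < dist x a} +
      v * θ.real {x | dist x a < dist x b} +
      2 * (∫⁻ x in {x | dist x a < dist x b}, W x ∂θ).toReal +
      w * θ.real {x | dist x a = dist x b} ≤ 1 := by
  have hQm : MeasurableSet {x : S | dist x a < dist x b} :=
    (isOpen_lt (by fun_prop) (by fun_prop)).measurableSet
  have hPm : MeasurableSet {x : S | dist x b < dist x a} :=
    (isOpen_lt (by fun_prop) (by fun_prop)).measurableSet
  have hRm : MeasurableSet {x : S | dist x a = dist x b} :=
    (isClosed_eq (by fun_prop) (by fun_prop)).measurableSet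
  rw [lintegral_farther_split a b] at hf
  have h1 := setLIntegral_mono' (μ := θ) hPm hP
  have h2 := setLIntegral_mono' (μ := θ) hQm hQ
  have h3 := setLIntegral_mono' (μ := θ) hRm hR
  rw [lintegral_add_right _ measurable_const, lintegral_const_mul _ hW] at h2
  rw [setLIntegral_const] at h1 h2 h3
  have h := (add_le_add h1 (add_le_add h2 h3)).trans hf
  set e := ∫⁻ x in {x | dist x a < dist x b}, W x ∂θ
  have he : e ≠ ∞ := by
    rintro he
    simp [he] at h
  have h' := ENNReal.toReal_mono ENNReal.one_ne_top h
  rw [ENNReal.toReal_add, ENNReal.toReal_add, ENNReal.toReal_add] at h'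
  · simp only [ENNReal.toReal_mul, ENNReal.toReal_ofReal hu, ENNReal.toReal_ofReal hv,
      ENNReal.toReal_ofReal hw, ENNReal.toReal_ofNat, ENNReal.toReal_one] at h'
    simp only [Measure.real]
    linarith
  all_goals finiteness

variable [SecondCountableTopology S] [IsProbabilityMeasure θ]

theorem measurable_measure_dist_lt_s12 :
    Measurable fun q : S × S => θ {z | dist q.1 z < dist q.1 q.2} := by
  have h : MeasurableSet {p : (S × S) × S | dist p.1.1 p.2 < dist p.1.1 p.1.2} :=
    (isOpen_lt (by fun_prop) (by fun_prop)).measurableSet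
  exact measurable_measure_prodMk_left h

theorem lintegral_two_mul_measure_dist_lt_le_one
    (hinv : ∀ A : Set S, MeasurableSet A → θ A = ∫⁻ x, K22 θ x A ∂θ) {a : S}
    (ha : a ∈ θ.support) : ∫⁻ x, 2 * θ {z | dist x z < dist x a} ∂θ ≤ 1 := by
  set g : S → ℝ≥0∞ := fun y => ∫⁻ x, 2 * θ {z | dist x z < dist x y} ∂θ with hg
  have hmeas : Measurable fun q : S × S => 2 * θ {z | dist q.1 z < dist q.1 q.2} :=
    measurable_measure_dist_lt_s12.const_mul 2
  have hlsc : LowerSemicontinuous g := by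
    refine lowerSemicontinuous_lintegral
      (fun y => hmeas.comp (measurable_id.prodMk measurable_const)) fun x => ?_
    simp_rw [two_mul]
    exact (lowerSemicontinuous_measure_dist_lt x).add (lowerSemicontinuous_measure_dist_lt x)
  have hO : IsOpen (g ⁻¹' Set.Ioi 1) := hlsc.isOpen_preimage 1
  have hle : ∫⁻ y in g ⁻¹' Set.Ioi 1, g y ∂θ ≤ θ (g ⁻¹' Set.Ioi 1) := by
    rw [hinv _ hO.measurableSet, hg,
      lintegral_lintegral_swap
        (f := fun y x => 2 * θ {z | dist x z < dist x y})
        (hmeas.comp measurable_swap).aemeasurable]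
    exact lintegral_mono fun x => lintegral_mono fun y => le_self_add
  have hnull : θ (g ⁻¹' Set.Ioi 1) = 0 := by
    by_contra h0
    have hlt : ∫⁻ _ in g ⁻¹' Set.Ioi 1, 1 ∂θ < ∫⁻ y in g ⁻¹' Set.Ioi 1, g y ∂θ := by
      refine setLIntegral_strict_mono hO.measurableSet h0 hlsc.measurable ?_ ?_
      · simp
      · exact Eventually.of_forall fun y hy => hy
    simp only [setLIntegral_one] at hlt
    exact absurd hle (not_le.2 hlt)
  by_contra h
  exact Measure.subset_compl_support_of_isOpen hO hnull (not_le.1 h) ha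

theorem lintegral_weight_eq_one
    (hinv : ∀ A : Set S, MeasurableSet A → θ A = ∫⁻ x, K22 θ x A ∂θ) {a : S}
    (ha : θ {a} ≠ 0) :
    ∫⁻ x, (2 * θ {z | dist x z < dist x a} + θ {z | dist x z = dist x a}) ∂θ = 1 := by
  have h := hinv {a} (measurableSet_singleton a)
  simp only [K22, lintegral_singleton] at h
  rw [lintegral_mul_const' _ _ (measure_ne_top _ _)] at h
  exact (ENNReal.mul_eq_right ha (measure_ne_top _ _)).1 h.symm

/-- The consequences of invariance at the point `a`, when `a` is (almost surely) the farthest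
point from every `x` that is farther from `a` than from `b`. -/
theorem farthest_point_bounds
    (hinv : ∀ A : Set S, MeasurableSet A → θ A = ∫⁻ x, K22 θ x A ∂θ) {a b : S} (hab : a ≠ b)
    (ha : a ∈ θ.support)
    (hfar : ∀ x, dist x b ≤ dist x a → ∀ᵐ z ∂θ, z ≠ a → z ≠ b → dist x z < dist x a) :
    ∃ e : ℝ, 0 ≤ e ∧
      (e = 0 → θ.real {x | dist x a < dist x b} ≤ θ.real {a}) ∧
      (2 * (1 - θ.real {a}) * θ.real {x | dist x b < dist x a} + e +
        2 * (1 - θ.real {a} - θ.real {b}) * θ.real {x | dist x a = dist x b} ≤ 1) ∧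
      (0 < θ.real {a} →
        (2 - θ.real {a}) * θ.real {x | dist x b < dist x a} +
        θ.real {a} * θ.real {x | dist x a < dist x b} + e +
        (2 - θ.real {a} - θ.real {b}) * θ.real {x | dist x a = dist x b} ≤ 1) := by
  have hadd : θ.real {a, b} = θ.real {a} + θ.real {b} := by
    rw [Set.insert_eq, measureReal_union (by simpa using hab) (measurableSet_singleton b)]
  have hle : θ.real {a, b} ≤ 1 := measureReal_le_one
  have hA : 0 ≤ θ.real {a} := measureReal_nonneg
  have hB : 0 ≤ θ.real {b} := measureReal_nonneg
  set W : S → ℝ≥0∞ := fun x => θ {z | dist x z < dist x a} with hWdef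
  have hW : Measurable W :=
    measurable_measure_dist_lt_s12.comp (measurable_id.prodMk measurable_const)
  have hballP : ∀ x, dist x b < dist x a → ENNReal.ofReal (1 - θ.real {a}) ≤ W x := by
    intro x hx
    refine ENNReal.ofReal_le_of_le_toReal (one_sub_real_le_of_ae ?_)
    filter_upwards [hfar x hx.le] with z hz hza
    by_cases hzb : z = b
    · simpa [hzb] using hx
    · exact hz hza hzb
  have hballR : ∀ x, dist x a = dist x b →
      ENNReal.ofReal (1 - θ.real {a} - θ.real {b}) ≤ W x := by
    intro x hx
    rw [sub_sub, ← hadd]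
    refine ENNReal.ofReal_le_of_le_toReal (one_sub_real_le_of_ae ?_)
    filter_upwards [hfar x hx.ge] with z hz hzab
    exact hz (fun h => hzab (by simp [h])) (fun h => hzab (by simp [h]))
  have hsphere : ∀ x, ENNReal.ofReal (θ.real {a}) ≤ θ {z | dist x z = dist x a} := by
    intro x
    rw [ofReal_measureReal]
    exact measure_mono (by simp)
  have hsphereR : ∀ x, dist x a = dist x b →
      ENNReal.ofReal (θ.real {a} + θ.real {b}) ≤ θ {z | dist x z = dist x a} := by
    intro x hx
    rw [← hadd, ofReal_measureReal]
    refine measure_mono ?_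
    rintro z (rfl | rfl)
    · rfl
    · exact hx.symm
  have htwo : ∀ c : ℝ, ENNReal.ofReal (2 * c) = 2 * ENNReal.ofReal c := fun c => by
    rw [ENNReal.ofReal_mul zero_le_two, ENNReal.ofReal_ofNat]
  refine ⟨2 * (∫⁻ x in {x | dist x a < dist x b}, W x ∂θ).toReal, by positivity, ?_, ?_, ?_⟩
  · intro he
    have hne : ∫⁻ x in {x | dist x a < dist x b}, W x ∂θ ≠ ∞ := by
      refine ne_top_of_le_ne_top (b := ∫⁻ x in {x | dist x a < dist x b}, 1 ∂θ)
        (by simp) (lintegral_mono fun x => prob_le_one)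
    have he0 := (ENNReal.toReal_eq_zero_iff _).1 (by linarith)
    have h0 := he0.resolve_right hne
    rw [lintegral_eq_zero_iff hW] at h0
    have h1 := (ae_restrict_iff' (isOpen_lt (f := fun x => dist x a) (g := fun x => dist x b)
      (by fun_prop) (by fun_prop)).measurableSet).1 h0
    refine ENNReal.toReal_mono (measure_ne_top _ _) (measure_mono_ae ?_)
    filter_upwards [h1, θ.support_mem_ae] with x hx hxs hxQ
    by_contra hxa
    have hpos : 0 < dist x a := dist_pos.2 hxa
    refine ((Measure.mem_support_iff_forall x).1 hxs _ ?_).ne' (hx hxQ)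
    exact (isOpen_lt (f := fun z => dist x z) (g := fun _ => dist x a)
      (by fun_prop) (by fun_prop)).mem_nhds (by simpa using fun h : x = a => hxa h)
  · have := farther_pieces_le_one (a := a) (b := b) (u := 2 * (1 - θ.real {a})) (v := 0)
      (w := 2 * (1 - θ.real {a} - θ.real {b})) (by linarith) le_rfl (by linarith) hW
      (lintegral_two_mul_measure_dist_lt_le_one hinv ha)
      (fun x hx => by rw [htwo]; gcongr; exact hballP x hx)
      (fun x _ => by simp [hWdef])
      (fun x hx => by rw [htwo]; gcongr; exact hballR x hx)
    linarith
  · intro hpos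
    have hne : θ {a} ≠ 0 := fun h => by simp [Measure.real, h] at hpos
    have := farther_pieces_le_one (a := a) (b := b) (u := 2 * (1 - θ.real {a}) + θ.real {a})
      (v := θ.real {a})
      (w := 2 * (1 - θ.real {a} - θ.real {b}) + (θ.real {a} + θ.real {b}))
      (by linarith) hA (by linarith) hW (lintegral_weight_eq_one hinv hne).le
      (fun x hx => by
        rw [ENNReal.ofReal_add (by linarith) hA, htwo]
        gcongr
        exacts [hballP x hx, hsphere x])
      (fun x _ => by
        gcongr
        exact hsphere x)
      (fun x hx => by
        rw [ENNReal.ofReal_add (by linarith) (by linarith), htwo]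
        gcongr
        exacts [hballR x hx, hsphereR x hx])
    linarith

/-- An invariant measure whose support contains two points `a`, `b` that are jointly farthest from
everything is uniform on `{a, b}`. -/
theorem eq_half_dirac_add_dirac
    (hinv : ∀ A : Set S, MeasurableSet A → θ A = ∫⁻ x, K22 θ x A ∂θ) {a b : S} (hab : a ≠ b)
    (ha : a ∈ θ.support) (hb : b ∈ θ.support)
    (hfar : ∀ x, ∀ᵐ z ∂θ, z ≠ a → z ≠ b → dist x z < max (dist x a) (dist x b)) :
    θ = (2 : ℝ≥0∞)⁻¹ • (Measure.dirac a + Measure.dirac b) := by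
  obtain ⟨e, he, hea, ha1, ha2⟩ := farthest_point_bounds hinv hab ha fun x hx => by
    simpa only [max_eq_left hx] using hfar x
  obtain ⟨e', he', heb, hb1, hb2⟩ := farthest_point_bounds hinv hab.symm hb fun x hx => by
    filter_upwards [hfar x] with z hz hzb hza
    simpa only [max_eq_right hx] using hz hza hzb
  have hRsymm : {x | dist x b = dist x a} = {x | dist x a = dist x b} := by
    ext x
    exact eq_comm
  rw [hRsymm] at hb1 hb2
  have hsum : θ.real {x | dist x b < dist x a} + θ.real {x | dist x a < dist x b} +
      θ.real {x | dist x a = dist x b} = 1 := by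
    have h := lintegral_farther_split (θ := θ) a b 1
    simp only [Pi.one_apply, lintegral_one, measure_univ,
      Measure.restrict_apply_univ] at h
    have h' := congrArg ENNReal.toReal h
    rw [ENNReal.toReal_add (by finiteness) (by finiteness),
      ENNReal.toReal_add (by finiteness) (by finiteness), ENNReal.toReal_one] at h'
    simp only [Measure.real]
    linarith
  have hQpos : 0 < θ.real {x | dist x a < dist x b} := by
    refine ENNReal.toReal_pos (ne_of_gt ?_) (measure_ne_top _ _)
    refine (Measure.mem_support_iff_forall a).1 ha _ ?_
    exact (isOpen_lt (f := fun x => dist x a) (g := fun x => dist x b)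
      (by fun_prop) (by fun_prop)).mem_nhds (by simpa using hab)
  have hPpos : 0 < θ.real {x | dist x b < dist x a} := by
    refine ENNReal.toReal_pos (ne_of_gt ?_) (measure_ne_top _ _)
    refine (Measure.mem_support_iff_forall b).1 hb _ ?_
    exact (isOpen_lt (f := fun x => dist x b) (g := fun x => dist x a)
      (by fun_prop) (by fun_prop)).mem_nhds (by simpa using hab.symm)
  have hAQ : θ.real {a} ≤ θ.real {x | dist x a < dist x b} :=
    measureReal_mono (by simpa using hab)
  have hBP : θ.real {b} ≤ θ.real {x | dist x b < dist x a} :=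
    measureReal_mono (by simpa using hab.symm)
  have hA0 : 0 ≤ θ.real {a} := measureReal_nonneg
  have hB0 : 0 ≤ θ.real {b} := measureReal_nonneg
  have hr0 : 0 ≤ θ.real {x | dist x a = dist x b} := measureReal_nonneg
  have hatoms : θ.real {a} = 1 / 2 ∧ θ.real {b} = 1 / 2 := by
    generalize θ.real {a} = A at *
    generalize θ.real {b} = B at *
    generalize θ.real {x | dist x b < dist x a} = p at *
    generalize θ.real {x | dist x a < dist x b} = q at *
    generalize θ.real {x | dist x a = dist x b} = r at *
    exact two_atom_arithmetic hsum hPpos hQpos hr0 hA0 hB0 hAQ hBP he he' hea heb ha1 ha2 hb1 hb2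
  have hpair : θ {a, b}ᶜ = 0 := by
    rw [prob_compl_eq_zero_iff ((Set.toFinite _).measurableSet), ← ENNReal.toReal_eq_one_iff,
      ← Measure.real, Set.insert_eq,
      measureReal_union (by simpa using hab) (measurableSet_singleton b), hatoms.1, hatoms.2]
    norm_num
  have hhalf : ∀ c : S, θ.real {c} = 1 / 2 → θ {c} = 2⁻¹ := fun c hc => by
    rw [← ofReal_measureReal, hc, one_div, ENNReal.ofReal_inv_of_pos two_pos,
      ENNReal.ofReal_ofNat]
  rw [← Measure.restrict_eq_self_of_ae_mem (μ := θ) (s := {a, b}) hpair, Set.insert_eq,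
    Measure.restrict_union (by simpa using hab) (measurableSet_singleton b),
    Measure.restrict_singleton, Measure.restrict_singleton, hhalf a hatoms.1,
    hhalf b hatoms.2, smul_add]

end Metric


theorem stmt_12 (θ : Measure unitInterval) [IsProbabilityMeasure θ]
    (hinv : ∀ A : Set unitInterval, MeasurableSet A → θ A = ∫⁻ x, K22 θ x A ∂θ) :
    (∃ s : unitInterval, θ = Measure.dirac s) ∨
      (∃ s₁ s₂ : unitInterval, s₁ ≠ s₂ ∧
        θ = (2 : ℝ≥0∞)⁻¹ • (Measure.dirac s₁ + Measure.dirac s₂)) := by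
  have hcomp : IsCompact θ.support := Measure.isClosed_support.isCompact
  have hne : θ.support.Nonempty := Measure.nonempty_support (IsProbabilityMeasure.ne_zero θ)
  obtain ⟨a, ha, hmin⟩ := hcomp.exists_isLeast hne
  obtain ⟨b, hb, hmax⟩ := hcomp.exists_isGreatest hne
  rcases eq_or_ne a b with rfl | hab
  · refine Or.inl ⟨a, ?_⟩
    have hsub : ∀ᵐ z ∂θ, z ∈ ({a} : Set unitInterval) := by
      filter_upwards [θ.support_mem_ae] with z hz
      exact le_antisymm (hmax hz) (hmin hz)
    have hone : θ {a} = 1 := (prob_compl_eq_zero_iff (measurableSet_singleton a)).1 hsub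
    rw [← Measure.restrict_eq_self_of_ae_mem hsub, Measure.restrict_singleton, hone, one_smul]
  · refine Or.inr ⟨a, b, hab, eq_half_dirac_add_dirac hinv hab ha hb fun x => ?_⟩
    filter_upwards [θ.support_mem_ae] with z hz hza hzb
    have h1 : (a : ℝ) < z := lt_of_le_of_ne (hmin hz) fun h => hza (Subtype.ext h.symm)
    have h2 : (z : ℝ) < b := lt_of_le_of_ne (hmax hz) fun h => hzb (Subtype.ext h)
    simp only [Subtype.dist_eq, Real.dist_eq, lt_max_iff]
    rcases le_total (x : ℝ) z with h | h
    · right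
      rw [abs_of_nonpos (by linarith), abs_of_nonpos (by linarith)]
      linarith
    · left
      rw [abs_of_nonneg (by linarith), abs_of_nonneg (by linarith)]
      linarith
end

section
/- Let θ be a π_{2,2}-invariant Borel probability measure on [0,1] (with the Euclidean metric) such that every open neighborhood of 0 and every open neighborhood of 1 has positive θ-measure (i.e. both 0 and 1 lie in the support of θ). Then θ = (δ_0 + δ_1)/2. -/
open MeasureTheory
open scoped ENNReal

/-- Expected sign of `dist x y - dist x z` for `x`, `z` independent with law `θ`. -/
noncomputable def meanSign {S : Type*} [MetricSpace S] [MeasurableSpace S]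
    (θ : Measure S) (y : S) : ℝ :=
  ∫ p : S × S, Real.sign (dist p.1 y - dist p.1 p.2) ∂(θ.prod θ)

lemma measurable_real_sign : Measurable Real.sign := by
  unfold Real.sign
  exact Measurable.ite measurableSet_Iio measurable_const
    (Measurable.ite measurableSet_Ioi measurable_const measurable_const)

lemma abs_real_sign_le (t : ℝ) : |Real.sign t| ≤ 1 := by
  rcases Real.sign_apply_eq t with h | h | h <;> simp [h]

section General

variable {S : Type*} [MetricSpace S] [SecondCountableTopology S] [MeasurableSpace S] [BorelSpace S]

lemma measurable_sign_dist (y : S) :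
    Measurable fun p : S × S => Real.sign (dist p.1 y - dist p.1 p.2) :=
  measurable_real_sign.comp (by fun_prop)

lemma integrable_of_measurable_of_abs_le {X : Type*} [MeasurableSpace X] {μ : Measure X}
    [IsFiniteMeasure μ] {f : X → ℝ} (hf : Measurable f) {C : ℝ} (hC : ∀ x, |f x| ≤ C) :
    Integrable f μ :=
  Integrable.of_bound hf.aestronglyMeasurable C (Filter.Eventually.of_forall hC)

lemma integrable_sign_dist (θ : Measure S) [IsProbabilityMeasure θ] (y : S) :
    Integrable (fun p : S × S => Real.sign (dist p.1 y - dist p.1 p.2)) (θ.prod θ) :=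
  integrable_of_measurable_of_abs_le (measurable_sign_dist y) fun _ => abs_real_sign_le _

lemma measurable_farther_weight (θ : Measure S) [IsProbabilityMeasure θ] :
    Measurable fun p : S × S =>
      2 * θ {z | dist p.1 z < dist p.1 p.2} + θ {z | dist p.1 z = dist p.1 p.2} := by
  have h₁ : MeasurableSet {q : (S × S) × S | dist q.1.1 q.2 < dist q.1.1 q.1.2} :=
    measurableSet_lt (by fun_prop) (by fun_prop)
  have h₂ : MeasurableSet {q : (S × S) × S | dist q.1.1 q.2 = dist q.1.1 q.1.2} :=
    measurableSet_eq_fun (by fun_prop) (by fun_prop)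
  exact ((measurable_measure_prodMk_left h₁).const_mul 2).add (measurable_measure_prodMk_left h₂)

lemma farther_weight_eq_lintegral (θ : Measure S) (x y : S) :
    2 * θ {z | dist x z < dist x y} + θ {z | dist x z = dist x y}
      = ∫⁻ z, ENNReal.ofReal (1 + Real.sign (dist x y - dist x z)) ∂θ := by
  have h₁ : MeasurableSet {z | dist x z < dist x y} :=
    measurableSet_lt (by fun_prop) (by fun_prop)
  have h₂ : MeasurableSet {z | dist x z = dist x y} :=
    measurableSet_eq_fun (by fun_prop) (by fun_prop)
  rw [← lintegral_indicator_one h₁, ← lintegral_indicator_one h₂, ← lintegral_const_mul,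
    ← lintegral_add_left]
  · refine lintegral_congr fun z => ?_
    rcases lt_trichotomy (dist x z) (dist x y) with h | h | h
    · rw [Real.sign_of_pos (sub_pos.2 h)]
      simp [h, h.ne]
      norm_num
    · simp [h]
    · rw [Real.sign_of_neg (sub_neg.2 h)]
      simp [h.not_gt, h.ne']
  · exact (measurable_one.indicator h₁).const_mul 2
  · exact measurable_one.indicator h₁

lemma lintegral_farther_weight (θ : Measure S) [IsProbabilityMeasure θ] (y : S) :
    ∫⁻ x, (2 * θ {z | dist x z < dist x y} + θ {z | dist x z = dist x y}) ∂θ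
      = ENNReal.ofReal (1 + meanSign θ y) := by
  have hint := (integrable_const (μ := θ.prod θ) (1 : ℝ)).add (integrable_sign_dist θ y)
  simp_rw [farther_weight_eq_lintegral]
  rw [← lintegral_prod (fun p : S × S =>
    ENNReal.ofReal (1 + Real.sign (dist p.1 y - dist p.1 p.2)))
    ((measurable_sign_dist y).const_add 1).ennreal_ofReal.aemeasurable]
  have := ofReal_integral_eq_lintegral_ofReal hint (Filter.Eventually.of_forall fun p => by
    have := (abs_le.1 (abs_real_sign_le (dist p.1 y - dist p.1 p.2))).1
    simp only [Pi.zero_apply, Pi.add_apply]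
    linarith)
  simp only [Pi.add_apply] at this
  rw [← this, integral_add (integrable_const _) (integrable_sign_dist θ y)]
  simp [meanSign]

lemma ae_meanSign_eq_zero (θ : Measure S) [IsProbabilityMeasure θ]
    (hinv : ∀ A : Set S, MeasurableSet A → θ A = ∫⁻ x, K22 θ x A ∂θ) :
    ∀ᵐ y ∂θ, meanSign θ y = 0 := by
  have hm := measurable_farther_weight θ
  have key : (fun _ : S => (1 : ℝ≥0∞)) =ᵐ[θ] fun y =>
      ∫⁻ x, (2 * θ {z | dist x z < dist x y} + θ {z | dist x z = dist x y}) ∂θ := by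
    refine ae_eq_of_forall_setLIntegral_eq_of_sigmaFinite measurable_const
      hm.lintegral_prod_left' fun A hA _ => ?_
    rw [setLIntegral_one, hinv A hA]
    exact lintegral_lintegral_swap (μ := θ) (ν := θ.restrict A) (f := fun x y =>
      2 * θ {z | dist x z < dist x y} + θ {z | dist x z = dist x y}) hm.aemeasurable
  filter_upwards [key] with y hy
  rw [lintegral_farther_weight, eq_comm, ENNReal.ofReal_eq_one] at hy
  linarith

lemma integral_sign_add_swap (θ : Measure S) [IsProbabilityMeasure θ] (y : S) :
    ∫ p : S × S, (Real.sign (dist p.1 y - dist p.1 p.2)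
      + Real.sign (dist p.2 y - dist p.2 p.1)) ∂(θ.prod θ) = 2 * meanSign θ y := by
  have hs := integral_prod_swap (μ := θ) (ν := θ)
    (fun p : S × S => Real.sign (dist p.1 y - dist p.1 p.2))
  simp only [Prod.fst_swap, Prod.snd_swap] at hs
  refine (integral_add (integrable_sign_dist θ y) (integrable_sign_dist θ y).swap).trans ?_
  simp only [Function.comp_apply, Prod.fst_swap, Prod.snd_swap, hs, meanSign]
  ring

end General

/-- The indicator of `(1/2, ∞)`, with value `1/2` at `1/2`. -/
noncomputable def halfStep (t : ℝ) : ℝ :=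
  if 1 / 2 < t then 1 else if t = 1 / 2 then 1 / 2 else 0

lemma measurable_halfStep : Measurable halfStep :=
  Measurable.ite measurableSet_Ioi measurable_const
    (Measurable.ite (measurableSet_singleton _) measurable_const measurable_const)

lemma abs_halfStep_le (t : ℝ) : |halfStep t| ≤ 1 := by
  unfold halfStep
  split_ifs <;> norm_num

lemma halfStep_add_halfStep_one_sub (t : ℝ) : halfStep t + halfStep (1 - t) = 1 := by
  unfold halfStep
  split_ifs <;> first | linarith | (exfalso; grind)

lemma sign_abs_sub_abs_of_pos {x y z : ℝ} (h : 0 < (z - y) * (2 * x - y - z)) :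
    Real.sign (|x - y| - |x - z|) = 1 :=
  Real.sign_of_pos (sub_pos.2 (sq_lt_sq.1 (by nlinarith)))

lemma sign_abs_sub_abs_of_neg {x y z : ℝ} (h : (z - y) * (2 * x - y - z) < 0) :
    Real.sign (|x - y| - |x - z|) = -1 :=
  Real.sign_of_neg (sub_neg.2 (sq_lt_sq.1 (by nlinarith)))

lemma sign_abs_sub_abs_of_eq {x y z : ℝ} (h : (z - y) * (2 * x - y - z) = 0) :
    Real.sign (|x - y| - |x - z|) = 0 := by
  have : |x - y| = |x - z| := (sq_eq_sq_iff_abs_eq_abs _ _).1 (by nlinarith)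
  simp [this]

lemma sign_pair_nonneg {x y z : ℝ} (hx : y < x) (hz : y < z) :
    0 ≤ Real.sign (|x - y| - |x - z|) + Real.sign (|z - y| - |z - x|) := by
  have key : ∀ {a b : ℝ}, y < a → y < b → b ≤ a →
      0 ≤ Real.sign (|a - y| - |a - b|) + Real.sign (|b - y| - |b - a|) := by
    intro a b ha hb hab
    rw [sign_abs_sub_abs_of_pos (mul_pos (by linarith) (by linarith))]
    linarith [(abs_le.1 (abs_real_sign_le (|b - y| - |b - a|))).1]
  rcases le_total z x with h | h
  · exact key hx hz h
  · rw [add_comm]; exact key hz hx h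

lemma sign_pair_ge_of_small {x y z : ℝ} (hy : y ≤ 1 / 3) (hx1 : x ≤ 1) (hz1 : z ≤ 1) :
    2 * ((Set.Ioi (2 / 3 : ℝ)).indicator 1 x * (Set.Ioi (2 / 3 : ℝ)).indicator 1 z)
        - 2 * ((Set.Iic y).indicator 1 x + (Set.Iic y).indicator 1 z)
      ≤ Real.sign (|x - y| - |x - z|) + Real.sign (|z - y| - |z - x|) := by
  have b₁ := (abs_le.1 (abs_real_sign_le (|x - y| - |x - z|))).1
  have b₂ := (abs_le.1 (abs_real_sign_le (|z - y| - |z - x|))).1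
  rcases le_or_gt x y with hx | hx
  · have h1 : ¬ (2 / 3 < x) := by linarith
    have : (0 : ℝ) ≤ (Set.Iic y).indicator 1 z := Set.indicator_nonneg (by simp) _
    simp only [Set.indicator, Set.mem_Ioi, Set.mem_Iic, h1, hx, if_true, if_false,
      Pi.one_apply] at this ⊢
    linarith
  rcases le_or_gt z y with hz | hz
  · have h1 : ¬ (2 / 3 < z) := by linarith
    simp only [Set.indicator, Set.mem_Ioi, Set.mem_Iic, h1, hz, hx.not_ge, if_true, if_false,
      Pi.one_apply]
    linarith
  by_cases h : 2 / 3 < x ∧ 2 / 3 < z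
  · rw [sign_abs_sub_abs_of_pos (mul_pos (by linarith) (by linarith)),
      sign_abs_sub_abs_of_pos (mul_pos (by linarith) (by linarith))]
    simp [Set.indicator, h.1, h.2, hx.not_ge, hz.not_ge]
    norm_num
  · have := sign_pair_nonneg hx hz
    have h0 : (Set.Ioi (2 / 3 : ℝ)).indicator (1 : ℝ → ℝ) x
        * (Set.Ioi (2 / 3 : ℝ)).indicator 1 z = 0 := by
      simp only [Set.indicator, Set.mem_Ioi]
      split_ifs <;> simp_all
    rw [h0]
    simpa [Set.indicator, hx.not_ge, hz.not_ge] using this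

lemma sign_pair_zero_ge {x z : ℝ} (hx0 : 0 ≤ x) (hx1 : x ≤ 1) (hz0 : 0 ≤ z) (hz1 : z ≤ 1) :
    2 * (halfStep x * halfStep z)
        - ((({0} : Set ℝ).indicator 1 x + ({0} : Set ℝ).indicator 1 z)
          - 2 * (({0} : Set ℝ).indicator 1 x * ({0} : Set ℝ).indicator 1 z))
      ≤ Real.sign (|x - 0| - |x - z|) + Real.sign (|z - 0| - |z - x|) := by
  have h00 : halfStep 0 = 0 := by norm_num [halfStep]
  rcases hx0.eq_or_lt with rfl | hx
  · rcases hz0.eq_or_lt with rfl | hz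
    · simp [h00]
      norm_num
    · rw [sign_abs_sub_abs_of_neg (by nlinarith), sign_abs_sub_abs_of_eq (by ring)]
      simp [h00, hz.ne']
  rcases hz0.eq_or_lt with rfl | hz
  · rw [sign_abs_sub_abs_of_eq (by ring), sign_abs_sub_abs_of_neg (by nlinarith)]
    simp [h00, hx.ne']
  have key : ∀ {a b : ℝ}, 0 < b → b ≤ a → a ≤ 1 → 2 * (halfStep a * halfStep b)
      ≤ Real.sign (|a - 0| - |a - b|) + Real.sign (|b - 0| - |b - a|) := by
    intro a b hb hab ha1
    rw [sign_abs_sub_abs_of_pos (mul_pos (by linarith) (by linarith))]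
    have hb2 := (abs_le.1 (abs_real_sign_le (|b - 0| - |b - a|))).1
    have ha := (abs_le.1 (abs_halfStep_le a)).2
    rcases lt_trichotomy b (1 / 2) with h | h | h
    · have : halfStep b = 0 := by simp only [halfStep]; rw [if_neg h.not_gt, if_neg h.ne]
      rw [this]
      linarith
    · have : halfStep b = 1 / 2 := by simp only [halfStep]; rw [if_neg h.not_gt, if_pos h]
      rw [this]
      rcases ha1.eq_or_lt with h1 | h1
      · rw [sign_abs_sub_abs_of_eq (by rw [h, h1]; norm_num)]
        linarith
      · rw [sign_abs_sub_abs_of_pos (mul_pos (by linarith) (by linarith))]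
        linarith
    · have : halfStep b = 1 := by simp only [halfStep]; rw [if_pos h]
      rw [this, sign_abs_sub_abs_of_pos (mul_pos (by linarith) (by linarith))]
      linarith
  have goal : 2 * (halfStep x * halfStep z)
      ≤ Real.sign (|x - 0| - |x - z|) + Real.sign (|z - 0| - |z - x|) := by
    rcases le_total z x with h | h
    · exact key hz h hx1
    · rw [add_comm, mul_comm (halfStep x)]; exact key hx h hz1
  simpa [hx.ne', hz.ne'] using goal

section Coordinate

variable {S : Type*} [MetricSpace S] [SecondCountableTopology S] [MeasurableSpace S] [BorelSpace S]
  {r : S → ℝ} {e : S}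

/-- In a space isometric to a subset of `[0, 1]`, whose endpoint `e` is in the support, the
endpoint is an atom as soon as the balanced points `meanSign θ y = 0` have full measure. -/
lemma measure_endpoint_ne_zero (θ : Measure S) [IsProbabilityMeasure θ] (hr : Measurable r)
    (hdist : ∀ x y, dist x y = |r x - r y|) (hr0 : ∀ x, 0 ≤ r x) (hr1 : ∀ x, r x ≤ 1)
    (he : r e = 0) (hbal : ∀ᵐ y ∂θ, meanSign θ y = 0)
    (hsupp : ∀ U : Set S, IsOpen U → e ∈ U → 0 < θ U) (hfar : 0 < θ {x | 2 / 3 < r x}) :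
    θ {e} ≠ 0 := by
  intro hz
  have hB : MeasurableSet {x | 2 / 3 < r x} := measurableSet_lt measurable_const hr
  have hBpos : 0 < θ.real {x | 2 / 3 < r x} :=
    ENNReal.toReal_pos hfar.ne' (measure_ne_top _ _)
  obtain ⟨U, heU, hUo, hU⟩ := Set.exists_isOpen_lt_of_lt ({e} : Set S)
    (ENNReal.ofReal (θ.real {x | 2 / 3 < r x} ^ 2 / 2))
    (by rw [hz]; exact ENNReal.ofReal_pos.2 (by positivity))
  obtain ⟨δ, hδ, hball⟩ := Metric.isOpen_iff.1 hUo e (heU rfl)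
  obtain ⟨y, hy, hbaly⟩ := Measure.exists_mem_of_measure_ne_zero_of_ae
    (hsupp (Metric.ball e (min δ (1 / 3))) Metric.isOpen_ball
      (Metric.mem_ball_self (by positivity))).ne' (ae_restrict_of_ae hbal)
  rw [Metric.mem_ball, hdist, he, sub_zero, abs_of_nonneg (hr0 y), lt_min_iff] at hy
  have hA : MeasurableSet {x | r x ≤ r y} := measurableSet_le hr measurable_const
  have hAU : θ.real {x | r x ≤ r y} < θ.real {x | 2 / 3 < r x} ^ 2 / 2 := by
    refine (ENNReal.lt_ofReal_iff_toReal_lt (measure_ne_top _ _)).1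
      ((measure_mono fun x hx => hball ?_).trans_lt hU)
    rw [Metric.mem_ball, hdist, he, sub_zero, abs_of_nonneg (hr0 x)]
    exact lt_of_le_of_lt hx hy.1
  have hBi : Integrable ({x | 2 / 3 < r x}.indicator (1 : S → ℝ)) θ :=
    (integrable_const (1 : ℝ)).indicator hB
  have hAi : Integrable ({x | r x ≤ r y}.indicator (1 : S → ℝ)) θ :=
    (integrable_const (1 : ℝ)).indicator hA
  have i₁ := (hBi.mul_prod hBi).const_mul 2
  have i₂ := ((hAi.comp_fst θ).add (hAi.comp_snd θ)).const_mul 2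
  simp only [Pi.add_apply] at i₂
  have hmono := integral_mono (i₁.sub i₂)
    ((integrable_sign_dist θ y).add (integrable_sign_dist θ y).swap) (fun p => by
      have := sign_pair_ge_of_small hy.2.le (hr1 p.1) (hr1 p.2)
      simpa [hdist, Set.indicator] using this)
  have hR := integral_sign_add_swap θ y
  simp only [Pi.add_apply, Function.comp_apply, Prod.fst_swap, Prod.snd_swap] at hmono
  rw [hR, hbaly, integral_sub' i₁ i₂, integral_const_mul, integral_const_mul, integral_prod_mul,
    integral_add (hAi.comp_fst θ) (hAi.comp_snd θ), integral_fun_fst, integral_fun_snd,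
    integral_indicator_one hB, integral_indicator_one hA] at hmono
  simp only [probReal_univ, one_smul] at hmono
  nlinarith

lemma sq_integral_halfStep_le (θ : Measure S) [IsProbabilityMeasure θ] (hr : Measurable r)
    (hdist : ∀ x y, dist x y = |r x - r y|) (hr0 : ∀ x, 0 ≤ r x) (hr1 : ∀ x, r x ≤ 1)
    (he : r e = 0) (hbal : meanSign θ e = 0) :
    (∫ x, halfStep (r x) ∂θ) ^ 2 ≤ θ.real {e} * (1 - θ.real {e}) := by
  have hmem : ∀ x, x = e ↔ r x = 0 := fun x => by
    rw [← dist_eq_zero, hdist, he, sub_zero, abs_eq_zero]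
  have hAi : Integrable (({e} : Set S).indicator (1 : S → ℝ)) θ :=
    (integrable_const (1 : ℝ)).indicator (measurableSet_singleton e)
  have hwi : Integrable (fun x => halfStep (r x)) θ :=
    integrable_of_measurable_of_abs_le (measurable_halfStep.comp hr) fun _ => abs_halfStep_le _
  have i₁ := (hwi.mul_prod hwi).const_mul 2
  have i₂ := (hAi.comp_fst θ).add (hAi.comp_snd θ)
  have i₃ := (hAi.mul_prod hAi).const_mul 2
  have hmono := integral_mono (i₁.sub (i₂.sub i₃))
    ((integrable_sign_dist θ e).add (integrable_sign_dist θ e).swap) (fun p => by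
      have := sign_pair_zero_ge (hr0 p.1) (hr1 p.1) (hr0 p.2) (hr1 p.2)
      simpa [hdist, Set.indicator, hmem, he] using this)
  have hR := integral_sign_add_swap θ e
  simp only [Pi.add_apply, Function.comp_apply, Prod.fst_swap, Prod.snd_swap] at hmono
  rw [hR, hbal, integral_sub' i₁ (i₂.sub i₃), integral_sub' i₂ i₃, integral_const_mul,
    integral_const_mul, integral_prod_mul (fun x => halfStep (r x)) fun x => halfStep (r x),
    integral_prod_mul, integral_add' (hAi.comp_fst θ) (hAi.comp_snd θ), integral_fun_fst, integral_fun_snd,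
    integral_indicator_one (measurableSet_singleton e)] at hmono
  simp only [probReal_univ, one_smul] at hmono
  nlinarith

end Coordinate

lemma meanSign_eq_zero_of_measure_ne_zero {S : Type*} [MetricSpace S] [MeasurableSpace S]
    {θ : Measure S} (hbal : ∀ᵐ y ∂θ, meanSign θ y = 0) {e : S} (he : θ {e} ≠ 0) :
    meanSign θ e = 0 := by
  by_contra h
  exact he (measure_mono_null (Set.singleton_subset_iff.2 h) hbal)

lemma eq_half_dirac_add_dirac_s13 {S : Type*} [MeasurableSpace S] [MeasurableSingletonClass S]
    (θ : Measure S) [IsProbabilityMeasure θ] {a b : S} (hab : a ≠ b)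
    (ha : θ {a} = 2⁻¹) (hb : θ {b} = 2⁻¹) :
    θ = (2 : ℝ≥0∞)⁻¹ • (Measure.dirac a + Measure.dirac b) := by
  have hd : Disjoint ({a} : Set S) {b} := Set.disjoint_singleton.2 hab
  have hfull : ∀ᵐ x ∂θ, x ∈ ({a} ∪ {b} : Set S) := by
    change ({a} ∪ {b} : Set S) ∈ ae θ
    rw [mem_ae_iff_prob_eq_one ((measurableSet_singleton a).union (measurableSet_singleton b)),
      measure_union hd (measurableSet_singleton b), ha, hb, ENNReal.inv_two_add_inv_two]
  rw [← Measure.restrict_eq_self_of_ae_mem hfull,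
    Measure.restrict_union hd (measurableSet_singleton b), Measure.restrict_singleton,
    Measure.restrict_singleton, ha, hb, smul_add]

theorem stmt_13 (θ : Measure unitInterval) [IsProbabilityMeasure θ]
    (hinv : ∀ A : Set unitInterval, MeasurableSet A → θ A = ∫⁻ x, K22 θ x A ∂θ)
    (h0 : ∀ U : Set unitInterval, IsOpen U → (0 : unitInterval) ∈ U → 0 < θ U)
    (h1 : ∀ U : Set unitInterval, IsOpen U → (1 : unitInterval) ∈ U → 0 < θ U) :
    θ = (2 : ℝ≥0∞)⁻¹ •
      (Measure.dirac (0 : unitInterval) + Measure.dirac (1 : unitInterval)) := by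
  have hbal := ae_meanSign_eq_zero θ hinv
  have hm : Measurable fun x : unitInterval => (x : ℝ) := measurable_subtype_coe
  have hm' : Measurable fun x : unitInterval => 1 - (x : ℝ) := hm.const_sub 1
  have hd : ∀ x y : unitInterval, dist x y = |(x : ℝ) - y| := fun _ _ => rfl
  have hd' : ∀ x y : unitInterval, dist x y = |(1 - (x : ℝ)) - (1 - y)| := fun x y => by
    rw [hd, abs_sub_comm]; congr 1; ring
  have hnn : ∀ x : unitInterval, 0 ≤ 1 - (x : ℝ) := fun x => sub_nonneg.2 x.2.2
  have hle : ∀ x : unitInterval, 1 - (x : ℝ) ≤ 1 := fun x => sub_le_self _ x.2.1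
  have a0 : θ {0} ≠ 0 := measure_endpoint_ne_zero (r := fun x : unitInterval => (x : ℝ)) θ hm hd
    (fun x => x.2.1) (fun x => x.2.2) rfl hbal h0
    (h1 _ (isOpen_lt continuous_const continuous_subtype_val) (by norm_num))
  have a1 : θ {1} ≠ 0 := measure_endpoint_ne_zero (r := fun x : unitInterval => 1 - (x : ℝ)) θ hm' hd'
    hnn hle (by simp) hbal h1
    (h0 _ (isOpen_lt continuous_const (continuous_const.sub continuous_subtype_val))
      (by norm_num))
  have e0 := sq_integral_halfStep_le (r := fun x : unitInterval => (x : ℝ)) (e := 0) θ hm hd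
    (fun x => x.2.1) (fun x => x.2.2) rfl (meanSign_eq_zero_of_measure_ne_zero hbal a0)
  have e1 := sq_integral_halfStep_le (r := fun x : unitInterval => 1 - (x : ℝ)) (e := 1) θ hm' hd'
    hnn hle (by simp) (meanSign_eq_zero_of_measure_ne_zero hbal a1)
  have hsum : ∫ x, halfStep (x : ℝ) ∂θ + ∫ x, halfStep (1 - (x : ℝ)) ∂θ = 1 := by
    refine (integral_add
      (integrable_of_measurable_of_abs_le (measurable_halfStep.comp hm) fun _ => abs_halfStep_le _)
      (integrable_of_measurable_of_abs_le (measurable_halfStep.comp hm') fun _ =>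
        abs_halfStep_le _)).symm.trans ?_
    simp [halfStep_add_halfStep_one_sub]
  set p := ∫ x, halfStep (x : ℝ) ∂θ
  set q := ∫ x, halfStep (1 - (x : ℝ)) ∂θ
  have hs : (θ.real {0} - 1 / 2) ^ 2 + (θ.real {1} - 1 / 2) ^ 2 ≤ 0 := by
    have : q = 1 - p := by linarith
    rw [this] at e1
    nlinarith [sq_nonneg (p - 1 / 2)]
  have half : ∀ {a : unitInterval}, θ.real {a} = 1 / 2 → θ {a} = 2⁻¹ := fun {a} h => by
    rw [← ofReal_measureReal, h, one_div, ENNReal.ofReal_inv_of_pos two_pos, ENNReal.ofReal_ofNat]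
  refine eq_half_dirac_add_dirac_s13 θ zero_ne_one (half ?_) (half ?_)
  · nlinarith [sq_nonneg (θ.real {0} - 1 / 2), sq_nonneg (θ.real {1} - 1 / 2)]
  · nlinarith [sq_nonneg (θ.real {0} - 1 / 2), sq_nonneg (θ.real {1} - 1 / 2)]
end

section
/- Let θ be a π_{2,2}-invariant Borel probability measure on [0,1] (with the Euclidean metric) with θ({0}) > 0 and θ({1}) > 0. Then θ = (δ_0 + δ_1)/2. -/
open MeasureTheory
open scoped ENNReal

/-- The density with respect to `θ` of the kernel `K22 θ x`, evaluated at `y`, as a real number. -/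
noncomputable def kernelDensity {S : Type*} [MetricSpace S] [MeasurableSpace S]
    (θ : Measure S) (y x : S) : ℝ :=
  2 * θ.real {z | dist x z < dist x y} + θ.real {z | dist x z = dist x y}

lemma kernelDensity_nonneg {S : Type*} [MetricSpace S] [MeasurableSpace S]
    (θ : Measure S) (y x : S) : 0 ≤ kernelDensity θ y x := by
  unfold kernelDensity; positivity

/-- If for almost every `x` in a ball around `e` the punctured ball of radius `2 * dist x e` around
`e` is null, then the ball minus its centre is null. -/
lemma measure_punctured_ball_eq_zero {S : Type*} [MetricSpace S] [MeasurableSpace S]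
    [SecondCountableTopology S] (θ : Measure S) {e : S} {r : ℝ}
    (h : ∀ᵐ x ∂θ, dist x e < r → θ {z | 0 < dist z e ∧ dist z e < 2 * dist x e} = 0) :
    θ {x | 0 < dist x e ∧ dist x e < r} = 0 := by
  set T := {x | 0 < dist x e ∧ θ {z | 0 < dist z e ∧ dist z e < 2 * dist x e} = 0}
  have hT : θ T = 0 := by
    refine measure_null_of_locally_null T fun x hx => ⟨_, mem_nhdsWithin_of_mem_nhds ?_, hx.2⟩
    have h1 : IsOpen {z : S | 0 < dist z e} := isOpen_lt (by fun_prop) (by fun_prop)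
    have h2 : IsOpen {z : S | dist z e < 2 * dist x e} := isOpen_lt (by fun_prop) (by fun_prop)
    exact (h1.inter h2).mem_nhds ⟨hx.1, lt_two_mul_self hx.1⟩
  refine measure_mono_null (fun x hx => ?_) (measure_union_null hT (ae_iff.1 h))
  by_cases hx' : θ {z | 0 < dist z e ∧ dist z e < 2 * dist x e} = 0
  · exact Or.inl ⟨hx.1, hx'⟩
  · exact Or.inr fun hn => hx' (hn hx.2)

section General

variable {S : Type*} [MetricSpace S] [MeasurableSpace S] [BorelSpace S]
  [SecondCountableTopology S] (θ : Measure S) [IsProbabilityMeasure θ]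

lemma measurable_kernelDensity (y : S) : Measurable (kernelDensity θ y) := by
  have h1 : MeasurableSet {q : S × S | dist q.1 q.2 < dist q.1 y} :=
    measurableSet_lt (by fun_prop) (by fun_prop)
  have h2 : MeasurableSet {q : S × S | dist q.1 q.2 = dist q.1 y} :=
    measurableSet_eq_fun (by fun_prop) (by fun_prop)
  exact ((measurable_measure_prodMk_left (ν := θ) h1).ennreal_toReal.const_mul 2).add
    (measurable_measure_prodMk_left (ν := θ) h2).ennreal_toReal

lemma integrable_kernelDensity (y : S) : Integrable (kernelDensity θ y) θ := by
  refine Integrable.of_bound (measurable_kernelDensity θ y).aestronglyMeasurable 3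
    (Filter.Eventually.of_forall fun x => ?_)
  rw [Real.norm_of_nonneg (kernelDensity_nonneg θ y x)]
  have h1 := measureReal_le_one (μ := θ) (s := {z | dist x z < dist x y})
  have h2 := measureReal_le_one (μ := θ) (s := {z | dist x z = dist x y})
  unfold kernelDensity
  linarith

lemma K22_singleton (y x : S) :
    K22 θ x {y} = ENNReal.ofReal (kernelDensity θ y x) * θ {y} := by
  rw [K22, lintegral_singleton, kernelDensity, ENNReal.ofReal_add (by positivity) (by positivity),
    ENNReal.ofReal_mul (by norm_num), ofReal_measureReal, ofReal_measureReal]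
  norm_num

/-- At an atom of an invariant measure, the kernel density averages to one. -/
lemma integral_kernelDensity_eq_one
    (hinv : ∀ A : Set S, MeasurableSet A → θ A = ∫⁻ x, K22 θ x A ∂θ)
    {y : S} (hy : 0 < θ {y}) : ∫ x, kernelDensity θ y x ∂θ = 1 := by
  have h := hinv {y} (measurableSet_singleton y)
  simp_rw [K22_singleton] at h
  rw [lintegral_mul_const' _ _ (measure_ne_top θ _)] at h
  have h' : ∫⁻ x, ENNReal.ofReal (kernelDensity θ y x) ∂θ = 1 := by
    refine (ENNReal.mul_left_inj hy.ne' (measure_ne_top θ {y})).1 ?_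
    rw [one_mul, ← h]
  rw [integral_eq_lintegral_of_nonneg_ae
    (Filter.Eventually.of_forall (kernelDensity_nonneg θ y))
    (measurable_kernelDensity θ y).aestronglyMeasurable, h', ENNReal.toReal_one]

/-- The lower bound for the density at an endpoint, constant on each side of the midpoint. -/
noncomputable def stepBound (m : ℝ) (e : S) : S → ℝ :=
  {x | dist x e < 1 / 2}.indicator (fun _ => θ.real {e}) +
    {x | dist x e = 1 / 2}.indicator (fun _ => 1 + m) +
    {x | 1 / 2 < dist x e}.indicator (fun _ => 2 - θ.real {e})

lemma measurableSet_dist_lt_half (e : S) : MeasurableSet {x | dist x e < 1 / 2} :=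
  measurableSet_lt (by fun_prop) (by fun_prop)

lemma measurableSet_dist_eq_half (e : S) : MeasurableSet {x | dist x e = 1 / 2} :=
  measurableSet_eq_fun (by fun_prop) (by fun_prop)

lemma measurableSet_half_lt_dist (e : S) : MeasurableSet {x | 1 / 2 < dist x e} :=
  measurableSet_lt (by fun_prop) (by fun_prop)

lemma integrable_stepBound (m : ℝ) (e : S) : Integrable (stepBound θ m e) θ :=
  (((integrable_const _).indicator (measurableSet_dist_lt_half e)).add
    ((integrable_const _).indicator (measurableSet_dist_eq_half e))).add
    ((integrable_const _).indicator (measurableSet_half_lt_dist e))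

lemma integral_stepBound (m : ℝ) (e : S) :
    ∫ x, stepBound θ m e x ∂θ =
      θ.real {x | dist x e < 1 / 2} * θ.real {e} + θ.real {x | dist x e = 1 / 2} * (1 + m) +
        θ.real {x | 1 / 2 < dist x e} * (2 - θ.real {e}) := by
  have i1 := (integrable_const (μ := θ) (θ.real {e})).indicator (measurableSet_dist_lt_half e)
  have i2 := (integrable_const (μ := θ) (1 + m)).indicator (measurableSet_dist_eq_half e)
  have i3 := (integrable_const (μ := θ) (2 - θ.real {e})).indicator (measurableSet_half_lt_dist e)
  rw [stepBound, integral_add' (i1.add i2) i3, integral_add' i1 i2,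
    integral_indicator_const _ (measurableSet_dist_lt_half e),
    integral_indicator_const _ (measurableSet_dist_eq_half e),
    integral_indicator_const _ (measurableSet_half_lt_dist e)]
  simp only [smul_eq_mul]

end General

section Interval

variable (θ : Measure unitInterval) [IsProbabilityMeasure θ]

/-- Near an endpoint, the density there dominates the mass of a punctured ball. -/
lemma kernelDensity_ge_of_dist_lt {e x : unitInterval} (he : e = 0 ∨ e = 1) :
    θ.real {e} + θ.real {z | 0 < dist z e ∧ dist z e < 2 * dist x e} ≤
      kernelDensity θ e x := by
  set A := {z | 0 < dist z e ∧ dist z e < 2 * dist x e}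
  have hA : A ⊆ {z | dist x z < dist x e} := by
    intro z hz
    obtain ⟨hz1, hz2⟩ := hz
    have := z.2.1; have := z.2.2; have := x.2.1; have := x.2.2
    simp only [Set.mem_ofPred_eq, Subtype.dist_eq, Real.dist_eq] at *
    rcases he with rfl | rfl <;> simp only [Set.Icc.coe_zero, Set.Icc.coe_one] at * <;>
      grind
  have he' : ({e} : Set unitInterval) ⊆ {z | dist x z = dist x e} := by
    rintro z rfl; rfl
  have h1 := measureReal_mono (μ := θ) hA
  have h2 := measureReal_mono (μ := θ) he'
  have h3 : 0 ≤ θ.real {z | dist x z < dist x e} := measureReal_nonneg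
  unfold kernelDensity
  linarith

lemma kernelDensity_ge_of_dist_eq_half {e x : unitInterval} (he : e = 0 ∨ e = 1)
    (hx : dist x e = 1 / 2) :
    1 + θ.real ({0, 1}ᶜ : Set unitInterval) ≤ kernelDensity θ e x := by
  have hx' : (x : ℝ) = 1 / 2 := by
    have := x.2.1; have := x.2.2
    simp only [Subtype.dist_eq, Real.dist_eq] at *
    rcases he with rfl | rfl <;> simp only [Set.Icc.coe_zero, Set.Icc.coe_one] at * <;>
      grind
  have hM : ({0, 1}ᶜ : Set unitInterval) ⊆ {z | dist x z < dist x e} := by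
    intro z hz
    simp only [Set.mem_compl_iff, Set.mem_insert_iff, Set.mem_singleton_iff, not_or] at hz
    have h0 := unitInterval.pos_iff_ne_zero.2 hz.1
    have h1 := unitInterval.lt_one_iff_ne_one.2 hz.2
    have h0 : 0 < (z : ℝ) := h0
    have h1 : (z : ℝ) < 1 := h1
    rw [Set.mem_ofPred_eq, hx, Subtype.dist_eq, Real.dist_eq, hx']
    grind
  have hU : {z | dist x z < dist x e} ∪ {z | dist x z = dist x e} = Set.univ := by
    ext z
    have := z.2.1; have := z.2.2
    simp only [Set.mem_union, Set.mem_ofPred_eq, Set.mem_univ, iff_true, ← le_iff_lt_or_eq]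
    rw [hx, Subtype.dist_eq, Real.dist_eq, hx']
    grind
  have h1 := measureReal_mono (μ := θ) hM
  have h2 := measureReal_union_le (μ := θ) {z | dist x z < dist x e} {z | dist x z = dist x e}
  rw [hU, probReal_univ] at h2
  unfold kernelDensity
  linarith

lemma kernelDensity_ge_of_half_lt_dist {e x : unitInterval} (he : e = 0 ∨ e = 1)
    (hx : 1 / 2 < dist x e) : 2 - θ.real {e} ≤ kernelDensity θ e x := by
  have hs : ({e}ᶜ : Set unitInterval) ⊆ {z | dist x z < dist x e} := by
    intro z hz
    have hz := dist_pos.2 (Set.mem_compl_singleton_iff.1 hz)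
    have := z.2.1; have := z.2.2; have := x.2.1; have := x.2.2
    simp only [Set.mem_ofPred_eq, Subtype.dist_eq, Real.dist_eq] at *
    rcases he with rfl | rfl <;> simp only [Set.Icc.coe_zero, Set.Icc.coe_one] at * <;>
      grind
  have he' : ({e} : Set unitInterval) ⊆ {z | dist x z = dist x e} := by
    rintro z rfl; rfl
  have h1 := measureReal_mono (μ := θ) hs
  have h2 := measureReal_mono (μ := θ) he'
  rw [probReal_compl_eq_one_sub (measurableSet_singleton e)] at h1
  unfold kernelDensity
  linarith

lemma stepBound_le_kernelDensity {e : unitInterval} (he : e = 0 ∨ e = 1) (x : unitInterval) :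
    stepBound θ (θ.real ({0, 1}ᶜ : Set unitInterval)) e x ≤ kernelDensity θ e x := by
  rcases lt_trichotomy (dist x e) (1 / 2) with hx | hx | hx
  · have h := kernelDensity_ge_of_dist_lt θ (x := x) he
    have h' : 0 ≤ θ.real {z | 0 < dist z e ∧ dist z e < 2 * dist x e} := measureReal_nonneg
    simp only [stepBound, Pi.add_apply, Set.indicator, Set.mem_ofPred_eq, hx, hx.ne, hx.le.not_gt,
      if_true, if_false]
    linarith
  · have h := kernelDensity_ge_of_dist_eq_half θ he hx
    simpa [stepBound, Set.indicator, hx] using h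
  · have h := kernelDensity_ge_of_half_lt_dist θ he hx
    simp only [stepBound, Pi.add_apply, Set.indicator, Set.mem_ofPred_eq, hx, hx.ne', hx.le.not_gt,
      if_true, if_false]
    linarith

/-- If the step bound has the same integral as the density, the half interval next to the endpoint
carries no mass besides that of the endpoint. -/
lemma measure_half_interval_eq_zero {e : unitInterval} (he : e = 0 ∨ e = 1)
    (h : ∫ x, kernelDensity θ e x ∂θ =
      ∫ x, stepBound θ (θ.real ({0, 1}ᶜ : Set unitInterval)) e x ∂θ) :
    θ {x | 0 < dist x e ∧ dist x e < 1 / 2} = 0 := by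
  have hae := (integral_eq_iff_of_ae_le (integrable_stepBound θ _ e)
    (integrable_kernelDensity θ e)
    (Filter.Eventually.of_forall (stepBound_le_kernelDensity θ he))).1 h.symm
  refine measure_punctured_ball_eq_zero θ ?_
  filter_upwards [hae] with x hx hxe
  have hb := kernelDensity_ge_of_dist_lt θ (x := x) he
  rw [← hx] at hb
  simp only [stepBound, Pi.add_apply, Set.indicator, Set.mem_ofPred_eq, hxe, hxe.ne,
    hxe.le.not_gt, if_true, if_false] at hb
  rw [← measureReal_eq_zero_iff]
  exact le_antisymm (by linarith) measureReal_nonneg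

lemma eq_half_smul_dirac_add_dirac {a : ℝ≥0∞} (h0 : θ {0} = a) (h1 : θ {1} = a)
    (hm : θ ({0, 1}ᶜ : Set unitInterval) = 0) :
    θ = (2 : ℝ≥0∞)⁻¹ • (Measure.dirac 0 + Measure.dirac 1) := by
  have hd : θ = a • (Measure.dirac 0 + Measure.dirac 1) := by
    have hr : θ.restrict {0, 1} = θ := Measure.restrict_eq_self_of_ae_mem (ae_iff.2 hm)
    rw [← hr, Set.insert_eq, Measure.restrict_union (by simp) (measurableSet_singleton _),
      Measure.restrict_singleton, Measure.restrict_singleton, h0, h1, smul_add]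
  have ha : a * 2 = 1 := by
    have := congrArg (fun μ : Measure unitInterval => μ Set.univ) hd
    simp only [measure_univ, Measure.smul_apply, Measure.add_apply, smul_eq_mul] at this
    rw [this, one_add_one_eq_two]
  rwa [← ENNReal.eq_inv_of_mul_eq_one_left ha]

end Interval

theorem stmt_15 (θ : Measure unitInterval) [IsProbabilityMeasure θ]
    (hinv : ∀ A : Set unitInterval, MeasurableSet A → θ A = ∫⁻ x, K22 θ x A ∂θ)
    (h0 : 0 < θ {(0 : unitInterval)}) (h1 : 0 < θ {(1 : unitInterval)}) :
    θ = (2 : ℝ≥0∞)⁻¹ •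
      (Measure.dirac (0 : unitInterval) + Measure.dirac (1 : unitInterval)) := by
  have i0 := integral_kernelDensity_eq_one θ hinv h0
  have i1 := integral_kernelDensity_eq_one θ hinv h1
  have b0 := integral_mono (integrable_stepBound θ _ 0) (integrable_kernelDensity θ 0)
    (stepBound_le_kernelDensity θ (.inl rfl))
  have b1 := integral_mono (integrable_stepBound θ _ 1) (integrable_kernelDensity θ 1)
    (stepBound_le_kernelDensity θ (.inr rfl))
  have z0 := measure_half_interval_eq_zero θ (e := 0) (.inl rfl)
  have z1 := measure_half_interval_eq_zero θ (e := 1) (.inr rfl)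
  rw [i0] at b0 z0
  rw [i1] at b1 z1
  rw [integral_stepBound] at b0 b1 z0 z1
  have d0 (x : unitInterval) : dist x 0 = x := by
    rw [Subtype.dist_eq, Real.dist_eq, Set.Icc.coe_zero, sub_zero, abs_of_nonneg x.2.1]
  have d1 (x : unitInterval) : dist x 1 = 1 - x := by
    rw [Subtype.dist_eq, Real.dist_eq, Set.Icc.coe_one, abs_sub_comm,
      abs_of_nonneg (sub_nonneg.2 x.2.2)]
  have e1 : {x : unitInterval | 1 - (x : ℝ) < 1 / 2} = {x : unitInterval | 1 / 2 < (x : ℝ)} := by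
    ext x; simp only [Set.mem_ofPred_eq]; constructor <;> intro <;> linarith
  have e2 : {x : unitInterval | 1 - (x : ℝ) = 1 / 2} = {x : unitInterval | (x : ℝ) = 1 / 2} := by
    ext x; simp only [Set.mem_ofPred_eq]; constructor <;> intro <;> linarith
  have e3 : {x : unitInterval | 1 / 2 < 1 - (x : ℝ)} = {x : unitInterval | (x : ℝ) < 1 / 2} := by
    ext x; simp only [Set.mem_ofPred_eq]; constructor <;> intro <;> linarith
  simp only [d0, d1, e1, e2, e3] at b0 b1 z0 z1
  set p := θ.real {x : unitInterval | (x : ℝ) < 1 / 2} with hp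
  set c := θ.real {x : unitInterval | (x : ℝ) = 1 / 2} with hc
  set q := θ.real {x : unitInterval | 1 / 2 < (x : ℝ)} with hq
  set m := θ.real ({0, 1}ᶜ : Set unitInterval) with hm
  set a := θ.real {(0 : unitInterval)} with ha
  set b := θ.real {(1 : unitInterval)} with hb
  have hpqc : p + c + q = 1 := by
    rw [hp, hc, hq, ← measureReal_union, ← measureReal_union, ← probReal_univ (μ := θ)]
    · congr 1
      ext x
      simpa [or_assoc] using lt_trichotomy (x : ℝ) (1 / 2)
    · exact Set.disjoint_left.2 fun x hx hx' => by
        simp only [Set.mem_union, Set.mem_ofPred_eq] at hx hx'; rcases hx with h | h <;> linarith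
    · exact measurableSet_lt (by fun_prop) (by fun_prop)
    · exact Set.disjoint_left.2 fun x hx hx' => by
        simp only [Set.mem_ofPred_eq] at hx hx'; linarith
    · exact measurableSet_eq_fun (by fun_prop) (by fun_prop)
  have ha0 : 0 < a := ENNReal.toReal_pos h0.ne' (measure_ne_top _ _)
  have hb0 : 0 < b := ENNReal.toReal_pos h1.ne' (measure_ne_top _ _)
  have hab : a + b ≤ 1 := by
    rw [ha, hb, ← measureReal_union (by simp) (measurableSet_singleton _)]
    exact measureReal_le_one
  have hc0 : 0 ≤ c := measureReal_nonneg
  have hm0 : 0 ≤ m := measureReal_nonneg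
  have hcm : c ≤ m := by
    refine measureReal_mono fun x hx => ?_
    rintro (rfl | rfl) <;> norm_num at hx
  have hmc : 0 ≤ m * c := mul_nonneg hm0 hc0
  have hcm' : c * (1 + m) = (1 - p - q) + m * c := by linear_combination hpqc
  have k0 : m * c ≤ (1 - a) * (p - q) := by linarith
  have k1 : m * c ≤ (1 - b) * (q - p) := by linarith
  have hpq : p = q := le_antisymm
    (sub_nonneg.1 (nonneg_of_mul_nonneg_right (hmc.trans k1) (by linarith)))
    (sub_nonneg.1 (nonneg_of_mul_nonneg_right (hmc.trans k0) (by linarith)))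
  have hc00 : c = 0 := by
    rw [hpq, sub_self, mul_zero] at k0
    have : c * c ≤ m * c := mul_le_mul_of_nonneg_right hcm hc0
    exact mul_self_eq_zero.1 (le_antisymm (by linarith) (mul_self_nonneg c))
  have hq2 : q = 1 / 2 := by linarith
  have z0 := z0 (by rw [hpq, hc00, hq2]; ring)
  have z1 := z1 (by rw [hpq, hc00, hq2]; ring)
  have zc : θ {x : unitInterval | (x : ℝ) = 1 / 2} = 0 := (measureReal_eq_zero_iff).1 hc00
  have hm' : θ ({0, 1}ᶜ : Set unitInterval) = 0 := by
    refine measure_mono_null (fun x hx => ?_) (measure_union_null (measure_union_null z0 z1) zc)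
    simp only [Set.mem_compl_iff, Set.mem_insert_iff, Set.mem_singleton_iff, not_or] at hx
    have hx0 : 0 < (x : ℝ) := unitInterval.pos_iff_ne_zero.2 hx.1
    have hx1 : (x : ℝ) < 1 := unitInterval.lt_one_iff_ne_one.2 hx.2
    rcases lt_trichotomy (x : ℝ) (1 / 2) with h | h | h
    · exact Or.inl (Or.inl ⟨hx0, h⟩)
    · exact Or.inr h
    · exact Or.inl (Or.inr ⟨by linarith, by linarith⟩)
  have hθ0 : θ {(0 : unitInterval)} = θ {x : unitInterval | (x : ℝ) < 1 / 2} := by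
    refine le_antisymm (measure_mono (by rintro x rfl; norm_num)) ?_
    refine (measure_mono fun x hx => ?_).trans
      ((measure_union_le {(0 : unitInterval)} _).trans (by rw [z0, add_zero]))
    rcases x.2.1.eq_or_lt with h | h
    · exact Or.inl (Subtype.ext h.symm)
    · exact Or.inr ⟨h, hx⟩
  have hθ1 : θ {(1 : unitInterval)} = θ {x : unitInterval | 1 / 2 < (x : ℝ)} := by
    refine le_antisymm (measure_mono (by rintro x rfl; norm_num)) ?_
    refine (measure_mono fun x hx => ?_).trans
      ((measure_union_le {(1 : unitInterval)} _).trans (by rw [z1, add_zero]))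
    rcases x.2.2.eq_or_lt with h | h
    · exact Or.inl (Subtype.ext h)
    · exact Or.inr ⟨by linarith, by linarith [Set.mem_ofPred_eq ▸ hx]⟩
  refine eq_half_smul_dirac_add_dirac θ hθ0 (hθ1.trans ?_) hm'
  exact ((measureReal_eq_measureReal_iff).1 hpq).symm
end

section
/- Let θ be a π_{1,2}-invariant Borel probability measure on the interval [0,1] (with the Euclidean metric d(x,y) = |x−y|). Then θ is either a point mass δ_s for some s ∈ [0,1], or a uniform two-point measure (δ_{s₁} + δ_{s₂})/2 for some s₁ ≠ s₂ in [0,1]. -/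
open MeasureTheory
open scoped ENNReal

/-- The score of `y` against `v`, seen from `u`: `2` if `y` is nearer to `u`, `1` for a tie,
and `0` otherwise. -/
noncomputable def nearerScore (y u v : ℝ) : ℝ :=
  2 * {p : ℝ × ℝ | |p.1 - y| < |p.1 - p.2|}.indicator 1 (u, v) +
    {p : ℝ × ℝ | |p.1 - p.2| = |p.1 - y|}.indicator 1 (u, v)

lemma nearerScore_eq (y u v : ℝ) : nearerScore y u v =
    if |u - y| < |u - v| then 2 else if |u - v| = |u - y| then 1 else 0 := by
  simp only [nearerScore, Set.indicator_apply, Set.mem_ofPred_eq, Pi.one_apply]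
  split_ifs with h₁ h₂ <;> first | exact absurd h₂ h₁.ne' | norm_num

lemma nearerScore_neg (y u v : ℝ) : nearerScore (-y) (-u) (-v) = nearerScore y u v := by
  have h (s t : ℝ) : |-s - -t| = |s - t| := by rw [← abs_neg]; ring_nf
  simp only [nearerScore_eq, h]

lemma nearerScore_le_two (y u v : ℝ) : nearerScore y u v ≤ 2 := by
  rw [nearerScore_eq]; split_ifs <;> norm_num

lemma nearerScore_le_one {y u v : ℝ} (h : |u - v| ≤ |u - y|) : nearerScore y u v ≤ 1 := by
  rw [nearerScore_eq, if_neg h.not_gt]; split_ifs <;> norm_num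

lemma nearerScore_eq_zero {y u v : ℝ} (h : |u - v| < |u - y|) : nearerScore y u v = 0 := by
  rw [nearerScore_eq, if_neg h.le.not_gt, if_neg h.ne]

lemma nearerScore_add_swap_le_two {y u v : ℝ} (hu : u < y) (hv : v < y) :
    nearerScore y u v + nearerScore y v u ≤ 2 := by
  wlog h : v ≤ u generalizing u v
  · rw [add_comm]; exact this hv hu (le_of_not_ge h)
  have := nearerScore_le_two y u v
  rw [nearerScore_eq_zero (u := v) (v := u)]
  · linarith
  · rw [abs_of_nonpos (by linarith), abs_of_nonpos (by linarith)]; linarith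

lemma nearerScore_add_swap_le_one {y u v : ℝ} (hu : u < y) (hv : v < y)
    (h₁ : 2 * u ≤ y + v) (h₂ : 2 * v ≤ y + u) :
    nearerScore y u v + nearerScore y v u ≤ 1 := by
  wlog h : v ≤ u generalizing u v
  · rw [add_comm]; exact this hv hu h₂ h₁ (le_of_not_ge h)
  rw [nearerScore_eq_zero (u := v) (v := u), add_zero]
  · apply nearerScore_le_one
    rw [abs_of_nonneg (by linarith), abs_of_nonpos (by linarith)]; linarith
  · rw [abs_of_nonpos (by linarith), abs_of_nonpos (by linarith)]; linarith

lemma nearerScore_add_swap_eq_zero {y u v : ℝ} (hu : u < y) (hv : v < y)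
    (h₁ : 2 * u < y + v) (h₂ : 2 * v < y + u) :
    nearerScore y u v + nearerScore y v u = 0 := by
  wlog h : v ≤ u generalizing u v
  · rw [add_comm]; exact this hv hu h₂ h₁ (le_of_not_ge h)
  rw [nearerScore_eq_zero (u := v) (v := u), add_zero]
  · apply nearerScore_eq_zero
    rw [abs_of_nonneg (by linarith), abs_of_nonpos (by linarith)]; linarith
  · rw [abs_of_nonpos (by linarith), abs_of_nonpos (by linarith)]; linarith

lemma ae_prod_and {Ω : Type*} [MeasurableSpace Ω] {θ : Measure Ω} [SFinite θ] {P : Ω → Prop}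
    (h : ∀ᵐ x ∂θ, P x) :
    ∀ᵐ p : Ω × Ω ∂(θ.prod θ), P p.1 ∧ P p.2 :=
  (Measure.quasiMeasurePreserving_fst.ae h).and (Measure.quasiMeasurePreserving_snd.ae h)

section

variable {Ω : Type*} [MeasurableSpace Ω] {θ : Measure Ω} [IsProbabilityMeasure θ] {X : Ω → ℝ}

lemma measurable_nearerScore (hX : Measurable X) (y : ℝ) :
    Measurable fun p : Ω × Ω => nearerScore y (X p.1) (X p.2) := by
  simp only [nearerScore_eq]
  refine Measurable.ite (measurableSet_lt ?_ ?_) measurable_const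
    (Measurable.ite (measurableSet_eq_fun ?_ ?_) measurable_const measurable_const) <;> fun_prop

lemma integrable_nearerScore (hX : Measurable X) (y : ℝ) :
    Integrable (fun p : Ω × Ω => nearerScore y (X p.1) (X p.2)) (θ.prod θ) := by
  refine Integrable.of_bound (measurable_nearerScore hX y).aestronglyMeasurable 2
    (Filter.Eventually.of_forall fun p => ?_)
  simp only [nearerScore_eq]
  split_ifs <;> norm_num

/-- Symmetrising a score of mean one. -/
lemma two_add_integral_le (hX : Measurable X) {y : ℝ}
    (hy : ∫ p : Ω × Ω, nearerScore y (X p.1) (X p.2) ∂(θ.prod θ) = 1)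
    {f g : Ω × Ω → ℝ} (hf : Integrable f (θ.prod θ)) (hg : Integrable g (θ.prod θ))
    (h : ∀ᵐ p ∂(θ.prod θ),
      nearerScore y (X p.1) (X p.2) + nearerScore y (X p.2) (X p.1) + f p ≤ g p) :
    2 + ∫ p, f p ∂(θ.prod θ) ≤ ∫ p, g p ∂(θ.prod θ) := by
  have hk := integrable_nearerScore (θ := θ) hX y
  have hk' : Integrable (fun p : Ω × Ω => nearerScore y (X p.2) (X p.1)) (θ.prod θ) := hk.swap
  have hs : ∫ p : Ω × Ω, nearerScore y (X p.2) (X p.1) ∂(θ.prod θ) = 1 := by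
    rw [← hy]
    exact integral_prod_swap (μ := θ) (ν := θ)
      (fun p : Ω × Ω => nearerScore y (X p.1) (X p.2))
  have := integral_mono_ae ((hk.add hk').add hf) hg h
  rw [integral_add' (hk.add hk') hf, integral_add' hk hk', hy, hs] at this
  linarith

lemma integrable_indicator_mul (hX : Measurable X) {A B : Set ℝ} (hA : MeasurableSet A)
    (hB : MeasurableSet B) :
    Integrable (fun p : Ω × Ω => A.indicator (1 : ℝ → ℝ) (X p.1) * B.indicator 1 (X p.2))
      (θ.prod θ) := by
  have h {C : Set ℝ} (hC : MeasurableSet C) :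
      Integrable (fun ω => C.indicator (1 : ℝ → ℝ) (X ω)) θ :=
    (integrable_const (1 : ℝ)).indicator (hX hC)
  exact (h hA).mul_prod (h hB)

lemma integral_indicator_mul (hX : Measurable X) {A B : Set ℝ} (hA : MeasurableSet A)
    (hB : MeasurableSet B) :
    ∫ p : Ω × Ω, A.indicator (1 : ℝ → ℝ) (X p.1) * B.indicator 1 (X p.2) ∂(θ.prod θ) =
      θ.real (X ⁻¹' A) * θ.real (X ⁻¹' B) := by
  have h {C : Set ℝ} (hC : MeasurableSet C) :
      ∫ ω, C.indicator (1 : ℝ → ℝ) (X ω) ∂θ = θ.real (X ⁻¹' C) :=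
    integral_indicator_one (hX hC)
  rw [integral_prod_mul (fun ω => A.indicator (1 : ℝ → ℝ) (X ω))
    (fun ω => B.indicator (1 : ℝ → ℝ) (X ω)), h hA, h hB]

lemma sq_measure_Iio_le (hX : Measurable X) {a c y : ℝ} (ha : ∀ᵐ x ∂θ, a ≤ X x)
    (hy : ∫ p : Ω × Ω, nearerScore y (X p.1) (X p.2) ∂(θ.prod θ) = 1)
    (hac : 2 * c - a ≤ y) :
    θ.real (X ⁻¹' Set.Iio c) ^ 2 ≤ 2 * θ.real (X ⁻¹' Set.Ici y) := by
  have i₁ := integrable_indicator_mul (θ := θ) hX (measurableSet_Iio (a := c))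
    (measurableSet_Iio (a := c))
  have i₂ := integrable_indicator_mul (θ := θ) hX MeasurableSet.univ (measurableSet_Ici (a := y))
  have i₃ := integrable_indicator_mul (θ := θ) hX (measurableSet_Ici (a := y)) MeasurableSet.univ
  have key := two_add_integral_le hX hy (i₁.const_mul 2)
    (((integrable_const (2 : ℝ)).add (i₂.const_mul 2)).add (i₃.const_mul 2)) (by
      filter_upwards [ae_prod_and ha] with p hp
      obtain ⟨hu, hv⟩ := hp
      simp only [Pi.add_apply]
      generalize X p.1 = u at *
      generalize X p.2 = v at *
      rcases lt_or_ge u y with hu' | hu' <;> rcases lt_or_ge v y with hv' | hv'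
      · rcases lt_or_ge u c with huc | huc <;> rcases lt_or_ge v c with hvc | hvc
        · have := nearerScore_add_swap_eq_zero hu' hv' (by linarith) (by linarith)
          simp [*]
        all_goals
          have := nearerScore_add_swap_le_two hu' hv'
          simp [*, not_lt.2, not_le.2]
      all_goals
        have h₁ := nearerScore_le_two y u v
        have h₂ := nearerScore_le_two y v u
        have h₃ : ¬ (u < c ∧ v < c) := by rintro ⟨_, _⟩; linarith
        have h₄ : (Set.Iio c).indicator (1 : ℝ → ℝ) u * (Set.Iio c).indicator 1 v = 0 := by
          simp only [Set.indicator_apply, Set.mem_Iio, Pi.one_apply]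
          split_ifs <;> simp_all
        rw [h₄]
        simp [*, not_le.2]
        linarith)
  rw [integral_add' ((integrable_const (2 : ℝ)).add (i₂.const_mul 2)) (i₃.const_mul 2),
    integral_add' (integrable_const (2 : ℝ)) (i₂.const_mul 2)] at key
  simp only [integral_const_mul] at key
  rw [integral_indicator_mul hX measurableSet_Iio measurableSet_Iio,
    integral_indicator_mul hX .univ measurableSet_Ici,
    integral_indicator_mul hX measurableSet_Ici .univ] at key
  simp at key
  nlinarith

/-- The top of the support carries an atom. -/
lemma measure_preimage_top_pos (hX : Measurable X) {a b : ℝ} (hab : a < b)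
    (hm : ∀ᵐ x ∂θ, a ≤ X x ∧ X x ≤ b)
    (ha : ∀ t > a, θ (X ⁻¹' Set.Iio t) ≠ 0) (hb : ∀ t < b, θ (X ⁻¹' Set.Ioi t) ≠ 0)
    (H : ∀ᵐ y ∂θ, ∫ p : Ω × Ω, nearerScore (X y) (X p.1) (X p.2) ∂(θ.prod θ) = 1) :
    θ (X ⁻¹' {b}) ≠ 0 := by
  set c := (3 * a + b) / 4 with hc_def
  have hpos : 0 < θ.real (X ⁻¹' Set.Iio c) :=
    ENNReal.toReal_pos (ha c (by linarith)) (measure_ne_top _ _)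
  have hbound (t : ℝ) (ht : (a + b) / 2 ≤ t) (htb : t < b) :
      θ.real (X ⁻¹' Set.Iio c) ^ 2 ≤ 2 * θ.real (X ⁻¹' Set.Ici t) := by
    obtain ⟨y, hyt, hy⟩ :=
      ((frequently_ae_mem_iff.2 (hb t htb)).and_eventually H).exists
    have hyt' : t < X y := hyt
    refine (sq_measure_Iio_le hX (hm.mono fun _ h => h.1) hy
      (by linarith)).trans ?_
    exact mul_le_mul_of_nonneg_left
      (measureReal_mono (Set.preimage_mono (Set.Ici_subset_Ici.2 hyt'.le))) two_pos.le
  have hlim : Filter.Tendsto (fun n : ℕ => θ.real (X ⁻¹' Set.Ici (b - (b - a) / 2 / (n + 1))))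
      Filter.atTop (nhds (θ.real (⋂ n : ℕ, X ⁻¹' Set.Ici (b - (b - a) / 2 / (n + 1))))) := by
    refine (ENNReal.tendsto_toReal (measure_ne_top _ _)).comp
      (tendsto_measure_iInter_atTop (fun n => (hX measurableSet_Ici).nullMeasurableSet) ?_
        ⟨0, measure_ne_top _ _⟩)
    intro m n hmn
    refine Set.preimage_mono (Set.Ici_subset_Ici.2 ?_)
    gcongr
  have hle := le_of_tendsto_of_tendsto' tendsto_const_nhds (hlim.const_mul 2) fun n =>
    hbound (b - (b - a) / 2 / (n + 1))
      (by
        have : (b - a) / 2 / ((n : ℝ) + 1) ≤ (b - a) / 2 :=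
          div_le_self (by linarith) (by linarith [n.cast_nonneg (α := ℝ)])
        linarith)
      (by have : 0 < (b - a) / 2 / ((n : ℝ) + 1) := div_pos (by linarith) (by positivity)
          linarith)
  intro h0
  have hnull : θ (⋂ n : ℕ, X ⁻¹' Set.Ici (b - (b - a) / 2 / (n + 1))) = 0 := by
    refine measure_mono_null_ae ?_ h0
    filter_upwards [hm] with x hx hxn
    refine le_antisymm hx.2 ?_
    have ht : Filter.Tendsto (fun n : ℕ => b - (b - a) / 2 / ((n : ℝ) + 1)) Filter.atTop
        (nhds (b - 0)) :=
      tendsto_const_nhds.sub (Filter.Tendsto.const_div_atTop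
        (Filter.tendsto_atTop_add_const_right _ _ tendsto_natCast_atTop_atTop) _)
    rw [sub_zero] at ht
    exact le_of_tendsto' ht fun n => Set.mem_iInter.1 hxn n
  rw [measureReal_def θ (⋂ n : ℕ, _), hnull, ENNReal.toReal_zero] at hle
  nlinarith

/-- The values of the indicators of the pieces into which `m` cuts `[a, b]`. -/
lemma indicator_cases {a m b w : ℝ} (ham : a < m) (hmb : m < b) (ha : a ≤ w) (hb : w ≤ b) :
    (w = a ∧ (Set.Ioc a m).indicator 1 w = (0 : ℝ) ∧ Set.indicator {a} 1 w = (1 : ℝ) ∧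
      (Set.Ioo a m).indicator 1 w = (0 : ℝ) ∧ Set.indicator {m} 1 w = (0 : ℝ) ∧
      Set.indicator {b} 1 w = (0 : ℝ) ∧ (Set.Iio b).indicator 1 w = (1 : ℝ)) ∨
    ((a < w ∧ w < m) ∧ (Set.Ioc a m).indicator 1 w = (1 : ℝ) ∧ Set.indicator {a} 1 w = (0 : ℝ) ∧
      (Set.Ioo a m).indicator 1 w = (1 : ℝ) ∧ Set.indicator {m} 1 w = (0 : ℝ) ∧
      Set.indicator {b} 1 w = (0 : ℝ) ∧ (Set.Iio b).indicator 1 w = (1 : ℝ)) ∨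
    (w = m ∧ (Set.Ioc a m).indicator 1 w = (1 : ℝ) ∧ Set.indicator {a} 1 w = (0 : ℝ) ∧
      (Set.Ioo a m).indicator 1 w = (0 : ℝ) ∧ Set.indicator {m} 1 w = (1 : ℝ) ∧
      Set.indicator {b} 1 w = (0 : ℝ) ∧ (Set.Iio b).indicator 1 w = (1 : ℝ)) ∨
    ((m < w ∧ w < b) ∧ (Set.Ioc a m).indicator 1 w = (0 : ℝ) ∧ Set.indicator {a} 1 w = (0 : ℝ) ∧
      (Set.Ioo a m).indicator 1 w = (0 : ℝ) ∧ Set.indicator {m} 1 w = (0 : ℝ) ∧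
      Set.indicator {b} 1 w = (0 : ℝ) ∧ (Set.Iio b).indicator 1 w = (1 : ℝ)) ∨
    (w = b ∧ (Set.Ioc a m).indicator 1 w = (0 : ℝ) ∧ Set.indicator {a} 1 w = (0 : ℝ) ∧
      (Set.Ioo a m).indicator 1 w = (0 : ℝ) ∧ Set.indicator {m} 1 w = (0 : ℝ) ∧
      Set.indicator {b} 1 w = (1 : ℝ) ∧ (Set.Iio b).indicator 1 w = (0 : ℝ)) := by
  simp only [Set.indicator_apply, Set.mem_Ioc, Set.mem_Ioo, Set.mem_singleton_iff, Set.mem_Iio,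
    Pi.one_apply]
  rcases (by grind : w = a ∨ (a < w ∧ w < m) ∨ w = m ∨ (m < w ∧ w < b) ∨ w = b) with
    h | h | h | h | h
  · exact .inl (by refine ⟨h, ?_, ?_, ?_, ?_, ?_, ?_⟩ <;> grind)
  · exact .inr (.inl (by refine ⟨h, ?_, ?_, ?_, ?_, ?_, ?_⟩ <;> grind))
  · exact .inr (.inr (.inl (by refine ⟨h, ?_, ?_, ?_, ?_, ?_, ?_⟩ <;> grind)))
  · exact .inr (.inr (.inr (.inl (by refine ⟨h, ?_, ?_, ?_, ?_, ?_, ?_⟩ <;> grind))))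
  · exact .inr (.inr (.inr (.inr (by refine ⟨h, ?_, ?_, ?_, ?_, ?_, ?_⟩ <;> grind))))

lemma top_atom_inequality (hX : Measurable X) {a b m : ℝ} (hab : a < b) (hmid : 2 * m = a + b)
    (hm : ∀ᵐ x ∂θ, a ≤ X x ∧ X x ≤ b)
    (hy : ∫ p : Ω × Ω, nearerScore b (X p.1) (X p.2) ∂(θ.prod θ) = 1) :
    θ.real (X ⁻¹' {a}) * (2 * θ.real (X ⁻¹' Set.Ioo a m) + θ.real (X ⁻¹' {m}) +
        θ.real (X ⁻¹' {a})) + θ.real (X ⁻¹' Set.Ioc a m) ^ 2 ≤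
      θ.real (X ⁻¹' {b}) * θ.real (X ⁻¹' Set.Iio b) := by
  have ham : a < m := by linarith
  have hmb : m < b := by linarith
  have i {A B : Set ℝ} (hA : MeasurableSet A) (hB : MeasurableSet B) :=
    integrable_indicator_mul (θ := θ) hX hA hB
  have sg (t : ℝ) : MeasurableSet ({t} : Set ℝ) := measurableSet_singleton t
  have oo : MeasurableSet (Set.Ioo a m) := measurableSet_Ioo
  have oc : MeasurableSet (Set.Ioc a m) := measurableSet_Ioc
  have io : MeasurableSet (Set.Iio b) := measurableSet_Iio
  have f₁ := (i oc oc).const_mul 2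
  have f₂ := f₁.add ((i (sg a) (sg a)).const_mul 2)
  have f₃ := f₂.add ((i (sg a) oo).const_mul 2)
  have f₄ := f₃.add ((i oo (sg a)).const_mul 2)
  have f₅ := f₄.add (i (sg a) (sg m))
  have f₆ := f₅.add (i (sg m) (sg a))
  have g₁ := (integrable_const (μ := θ.prod θ) (2 : ℝ)).add (i (sg b) io)
  have g₂ := g₁.add (i io (sg b))
  have key := two_add_integral_le hX hy f₆ g₂ (by
    filter_upwards [ae_prod_and hm] with p hp
    obtain ⟨⟨hu, hu'⟩, ⟨hv, hv'⟩⟩ := hp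
    simp only [Pi.add_apply]
    generalize X p.1 = u at *
    generalize X p.2 = v at *
    rcases indicator_cases ham hmb hu hu' with
      ⟨h₀, h₁, h₂, h₃, h₄, h₅, h₆⟩ | ⟨⟨_, _⟩, h₁, h₂, h₃, h₄, h₅, h₆⟩ |
      ⟨h₀, h₁, h₂, h₃, h₄, h₅, h₆⟩ | ⟨⟨_, _⟩, h₁, h₂, h₃, h₄, h₅, h₆⟩ |
      ⟨h₀, h₁, h₂, h₃, h₄, h₅, h₆⟩ <;>
    rcases indicator_cases ham hmb hv hv' with
      ⟨k₀, k₁, k₂, k₃, k₄, k₅, k₆⟩ | ⟨⟨_, _⟩, k₁, k₂, k₃, k₄, k₅, k₆⟩ |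
      ⟨k₀, k₁, k₂, k₃, k₄, k₅, k₆⟩ | ⟨⟨_, _⟩, k₁, k₂, k₃, k₄, k₅, k₆⟩ |
      ⟨k₀, k₁, k₂, k₃, k₄, k₅, k₆⟩ <;>
    rw [h₁, h₂, h₃, h₄, h₅, h₆, k₁, k₂, k₃, k₄, k₅, k₆] <;>
    first
    | linarith [nearerScore_add_swap_le_two (y := b) (u := u) (v := v) (by linarith) (by linarith)]
    | linarith [nearerScore_add_swap_le_one (y := b) (u := u) (v := v) (by linarith) (by linarith)
        (by linarith) (by linarith)]
    | linarith [nearerScore_add_swap_eq_zero (y := b) (u := u) (v := v) (by linarith)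
        (by linarith) (by linarith) (by linarith)]
    | linarith [nearerScore_le_one (y := b) (u := u) (v := v) (by subst h₀ k₀; rfl),
        nearerScore_le_one (y := b) (u := v) (v := u) (by subst h₀ k₀; rfl)]
    | linarith [nearerScore_le_one (y := b) (u := v) (v := u) (by exact (congrArg (|v - ·|) h₀).le),
        nearerScore_le_two b u v]
    | linarith [nearerScore_le_one (y := b) (u := u) (v := v) (by exact (congrArg (|u - ·|) k₀).le),
        nearerScore_le_two b v u])
  rw [integral_add' f₅ (i (sg m) (sg a)), integral_add' f₄ (i (sg a) (sg m)),
    integral_add' f₃ ((i oo (sg a)).const_mul 2), integral_add' f₂ ((i (sg a) oo).const_mul 2),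
    integral_add' f₁ ((i (sg a) (sg a)).const_mul 2), integral_add' g₁ (i io (sg b)),
    integral_add' (integrable_const (2 : ℝ)) (i (sg b) io)] at key
  simp only [integral_const_mul] at key
  rw [integral_indicator_mul hX oc oc, integral_indicator_mul hX (sg a) (sg a),
    integral_indicator_mul hX (sg a) oo, integral_indicator_mul hX oo (sg a),
    integral_indicator_mul hX (sg a) (sg m), integral_indicator_mul hX (sg m) (sg a),
    integral_indicator_mul hX (sg b) io, integral_indicator_mul hX io (sg b)] at key
  simp at key
  nlinarith

lemma eq_zero_of_atom_inequalities {p q L M R : ℝ} (hL : 0 ≤ L) (hM : 0 ≤ M) (hR : 0 ≤ R)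
    (h₁ : q * (2 * L + M + q) + (L + M) ^ 2 ≤ p * (q + L + M + R))
    (h₂ : p * (2 * R + M + p) + (M + R) ^ 2 ≤ q * (p + L + M + R)) :
    L = 0 ∧ M = 0 ∧ R = 0 ∧ p = q := by
  have h : (p - q + (R - L) / 2) ^ 2 + 3 / 4 * (L ^ 2 + R ^ 2) + 2 * M ^ 2 ≤ 0 := by
    nlinarith [mul_nonneg hL hR, mul_nonneg hL hM, mul_nonneg hM hR]
  have hL0 : L = 0 := by
    nlinarith [sq_nonneg (p - q + (R - L) / 2), sq_nonneg R, sq_nonneg M]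
  have hR0 : R = 0 := by
    nlinarith [sq_nonneg (p - q + (R - L) / 2), sq_nonneg L, sq_nonneg M]
  have hM0 : M = 0 := by
    nlinarith [sq_nonneg (p - q + (R - L) / 2), sq_nonneg R, sq_nonneg L]
  subst hL0 hR0 hM0
  exact ⟨rfl, rfl, rfl, by nlinarith [sq_nonneg (p - q)]⟩

/-- Both ends of the support are atoms of mass `1/2`. -/
lemma measure_endpoints (hX : Measurable X) {a b : ℝ} (hab : a < b)
    (hm : ∀ᵐ x ∂θ, a ≤ X x ∧ X x ≤ b)
    (ha : ∀ t > a, θ (X ⁻¹' Set.Iio t) ≠ 0) (hb : ∀ t < b, θ (X ⁻¹' Set.Ioi t) ≠ 0)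
    (H : ∀ᵐ y ∂θ, ∫ p : Ω × Ω, nearerScore (X y) (X p.1) (X p.2) ∂(θ.prod θ) = 1) :
    θ.real (X ⁻¹' {a}) = 1 / 2 ∧ θ.real (X ⁻¹' {b}) = 1 / 2 := by
  have hm' : ∀ᵐ x ∂θ, -b ≤ -X x ∧ -X x ≤ -a := by
    filter_upwards [hm] with x hx using ⟨neg_le_neg hx.2, neg_le_neg hx.1⟩
  have pre (A : Set ℝ) : (-X) ⁻¹' A = X ⁻¹' (-A) := rfl
  have htop := measure_preimage_top_pos hX hab hm ha hb H
  have hbot := measure_preimage_top_pos hX.neg (neg_lt_neg hab) hm'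
    (fun t ht => by rw [pre, Set.neg_Iio]; exact hb (-t) (by linarith))
    (fun t ht => by rw [pre, Set.neg_Ioi]; exact ha (-t) (by linarith))
    (by simpa only [Pi.neg_apply, nearerScore_neg] using H)
  rw [pre, Set.neg_singleton, neg_neg] at hbot
  have score {c : ℝ} (hc : θ (X ⁻¹' {c}) ≠ 0) :
      ∫ p : Ω × Ω, nearerScore c (X p.1) (X p.2) ∂(θ.prod θ) = 1 := by
    obtain ⟨y, hyc, hy⟩ := ((frequently_ae_mem_iff.2 hc).and_eventually H).exists
    rwa [show X y = c from hyc] at hy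
  have ht := top_atom_inequality hX hab (m := (a + b) / 2) (by ring) hm (score htop)
  have hs := top_atom_inequality hX.neg (neg_lt_neg hab) (m := -((a + b) / 2)) (by ring) hm'
    (by simpa only [Pi.neg_apply, nearerScore_neg] using score hbot)
  simp only [pre, Set.neg_singleton, neg_neg, Set.neg_Ioo, Set.neg_Ioc, Set.neg_Iio] at hs
  have ham : a < (a + b) / 2 := by linarith
  have hmb : (a + b) / 2 < b := by linarith
  generalize (a + b) / 2 = m at *
  have cut {A B C : Set ℝ} (hB : MeasurableSet B) (hd : Disjoint A B)
      (hC : ∀ w, a ≤ w → w ≤ b → (w ∈ C ↔ w ∈ A ∪ B)) :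
      θ.real (X ⁻¹' C) = θ.real (X ⁻¹' A) + θ.real (X ⁻¹' B) := by
    rw [← measureReal_union (hd.preimage X) (hX hB), ← Set.preimage_union]
    refine measureReal_congr ?_
    filter_upwards [hm] with x hx
    exact propext (hC (X x) hx.1 hx.2)
  have e₁ := cut (A := Set.Ioo a m) (B := {m}) (C := Set.Ioc a m) (measurableSet_singleton m)
    (by simp) (by intros; simp; grind)
  have e₂ := cut (A := Set.Ioo m b) (B := {m}) (C := Set.Ico m b) (measurableSet_singleton m)
    (by simp) (by intros; simp; grind)
  have e₃ := cut (A := Set.Ioc a m) (B := Set.Ioo m b) (C := Set.Ioo a b) measurableSet_Ioo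
    (by rw [Set.disjoint_left]; simp; grind) (by intros; simp; grind)
  have e₄ := cut (A := Set.Ioo a b) (B := {a}) (C := Set.Iio b) (measurableSet_singleton a)
    (by simp) (by intros; simp; grind)
  have e₅ := cut (A := Set.Ioo a b) (B := {b}) (C := Set.Ioi a) (measurableSet_singleton b)
    (by simp) (by intros; simp; grind)
  have e₆ := cut (A := Set.Iio b) (B := {b}) (C := Set.univ) (measurableSet_singleton b)
    (by simp) (by intros; simp; grind)
  rw [Set.preimage_univ, probReal_univ] at e₆
  obtain ⟨hL, hM, hR, hpq⟩ := eq_zero_of_atom_inequalities (p := θ.real (X ⁻¹' {b}))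
    (q := θ.real (X ⁻¹' {a})) (L := θ.real (X ⁻¹' Set.Ioo a m)) (M := θ.real (X ⁻¹' {m}))
    (R := θ.real (X ⁻¹' Set.Ioo m b)) measureReal_nonneg measureReal_nonneg measureReal_nonneg
    (by rw [e₄, e₃, e₁] at ht; linarith) (by rw [e₅, e₃, e₂, e₁] at hs; linarith)
  constructor <;> linarith

end

lemma ae_integral_nearerScore_eq_one (θ : Measure unitInterval) [IsProbabilityMeasure θ]
    (hinv : ∀ A : Set unitInterval, MeasurableSet A → θ A = ∫⁻ x, K12 θ x A ∂θ) :
    ∀ᵐ y : unitInterval ∂θ, ∫ p : unitInterval × unitInterval,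
      nearerScore (y : ℝ) (p.1 : ℝ) (p.2 : ℝ) ∂(θ.prod θ) = 1 := by
  have m₁ : Measurable fun q : unitInterval × unitInterval =>
      θ {z | dist q.1 q.2 < dist q.1 z} :=
    measurable_measure_prodMk_left (s := {r : (unitInterval × unitInterval) × unitInterval |
      dist r.1.1 r.1.2 < dist r.1.1 r.2}) (measurableSet_lt (by fun_prop) (by fun_prop))
  have m₂ : Measurable fun q : unitInterval × unitInterval =>
      θ {z | dist q.1 z = dist q.1 q.2} :=
    measurable_measure_prodMk_left (s := {r : (unitInterval × unitInterval) × unitInterval |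
      dist r.1.1 r.2 = dist r.1.1 r.1.2}) (measurableSet_eq_fun (by fun_prop) (by fun_prop))
  have mg := (m₁.const_mul 2).add m₂
  have hF : (fun y => ∫⁻ x, (2 * θ {z | dist x y < dist x z} +
      θ {z | dist x z = dist x y}) ∂θ) =ᵐ[θ] fun _ => 1 := by
    refine ae_eq_of_forall_setLIntegral_eq_of_sigmaFinite
      (mg.comp measurable_swap).lintegral_prod_right' measurable_const fun A hA _ => ?_
    rw [setLIntegral_one, hinv A hA]
    exact (lintegral_lintegral_swap (μ := θ) (ν := θ.restrict A) (f := fun x y =>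
      2 * θ {z | dist x y < dist x z} + θ {z | dist x z = dist x y}) mg.aemeasurable).symm
  filter_upwards [hF] with y hy
  have mS : MeasurableSet {p : unitInterval × unitInterval | dist p.1 y < dist p.1 p.2} :=
    measurableSet_lt (by fun_prop) (by fun_prop)
  have mT : MeasurableSet {p : unitInterval × unitInterval | dist p.1 p.2 = dist p.1 y} :=
    measurableSet_eq_fun (by fun_prop) (by fun_prop)
  have hy' : 2 * (θ.prod θ) {p | dist p.1 y < dist p.1 p.2} +
      (θ.prod θ) {p | dist p.1 p.2 = dist p.1 y} = 1 := by
    rw [Measure.prod_apply mS, Measure.prod_apply mT, ← lintegral_const_mul _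
      (measurable_measure_prodMk_left mS), ← lintegral_add_left
      ((measurable_measure_prodMk_left mS).const_mul 2)]
    exact hy
  have hr := congrArg ENNReal.toReal hy'
  rw [ENNReal.toReal_add (by finiteness) (by finiteness), ENNReal.toReal_mul] at hr
  have hs : ∀ p : unitInterval × unitInterval, nearerScore (y : ℝ) (p.1 : ℝ) (p.2 : ℝ) =
      2 * {p : unitInterval × unitInterval | dist p.1 y < dist p.1 p.2}.indicator 1 p +
        {p : unitInterval × unitInterval | dist p.1 p.2 = dist p.1 y}.indicator 1 p :=
    fun p => rfl
  have hi {E : Set (unitInterval × unitInterval)} (hE : MeasurableSet E) :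
      Integrable (E.indicator (1 : unitInterval × unitInterval → ℝ)) (θ.prod θ) :=
    (integrable_const (1 : ℝ)).indicator hE
  simp only [hs]
  rw [integral_add ((hi mS).const_mul 2) (hi mT), integral_const_mul, integral_indicator_one mS,
    integral_indicator_one mT]
  simpa [measureReal_def] using hr

theorem stmt_16 (θ : Measure unitInterval) [IsProbabilityMeasure θ]
    (hinv : ∀ A : Set unitInterval, MeasurableSet A → θ A = ∫⁻ x, K12 θ x A ∂θ) :
    (∃ s : unitInterval, θ = Measure.dirac s) ∨
      (∃ s₁ s₂ : unitInterval, s₁ ≠ s₂ ∧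
        θ = (2 : ℝ≥0∞)⁻¹ • (Measure.dirac s₁ + Measure.dirac s₂)) := by
  have H := ae_integral_nearerScore_eq_one θ hinv
  have hcomp : IsCompact θ.support := Measure.isClosed_support.isCompact
  have hne : θ.support.Nonempty := Measure.nonempty_support (IsProbabilityMeasure.ne_zero θ)
  obtain ⟨a, ha, hamin⟩ := hcomp.exists_isLeast hne
  obtain ⟨b, hb, hbmax⟩ := hcomp.exists_isGreatest hne
  have hm : ∀ᵐ x ∂θ, a ≤ x ∧ x ≤ b := by
    filter_upwards [Measure.support_mem_ae (μ := θ)] with x hx using ⟨hamin hx, hbmax hx⟩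
  rcases (hamin hb).eq_or_lt with rfl | hab
  · refine .inl ⟨a, ?_⟩
    have hs : ∀ᵐ x ∂θ, x ∈ ({a} : Set unitInterval) := by
      filter_upwards [hm] with x hx using le_antisymm hx.2 hx.1
    have h1 : θ {a} = 1 := (mem_ae_iff_prob_eq_one (measurableSet_singleton a)).1 hs
    rw [← Measure.restrict_eq_self_of_ae_mem hs, Measure.restrict_singleton, h1, one_smul]
  · refine .inr ⟨a, b, hab.ne, ?_⟩
    have pre (c : unitInterval) : (Subtype.val : unitInterval → ℝ) ⁻¹' {(c : ℝ)} = {c} := by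
      ext x; simp [Subtype.ext_iff]
    obtain ⟨hqa, hqb⟩ := measure_endpoints (X := ((↑) : unitInterval → ℝ))
      measurable_subtype_coe (a := a) (b := b) hab hm
      (fun t ht => ((Measure.mem_support_iff_forall a).1 ha _
        ((isOpen_Iio.preimage continuous_subtype_val).mem_nhds ht)).ne')
      (fun t ht => ((Measure.mem_support_iff_forall b).1 hb _
        ((isOpen_Ioi.preimage continuous_subtype_val).mem_nhds ht)).ne') H
    rw [pre] at hqa hqb
    have half {c : unitInterval} (hc : θ.real {c} = 1 / 2) : θ {c} = 2⁻¹ := by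
      rw [← ENNReal.toReal_eq_toReal_iff' (measure_ne_top _ _) (by simp)]
      simpa [measureReal_def] using hc
    have hd : Disjoint ({a} : Set unitInterval) {b} := by simpa using hab.ne
    have hs : ∀ᵐ x ∂θ, x ∈ ({a} ∪ {b} : Set unitInterval) := by
      have hu : θ ({a} ∪ {b}) = 1 := by
        rw [measure_union hd (measurableSet_singleton b), half hqa, half hqb,
          ENNReal.inv_two_add_inv_two]
      exact mem_ae_iff_prob_eq_one
        ((measurableSet_singleton a).union (measurableSet_singleton b)) |>.2 hu
    rw [← Measure.restrict_eq_self_of_ae_mem hs,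
      Measure.restrict_union hd (measurableSet_singleton b), Measure.restrict_singleton,
      Measure.restrict_singleton, half hqa, half hqb, smul_add]
end

section
/- Let S = {a,b} be a metric space with exactly two distinct points and let θ be the probability measure with θ({a}) = p ∈ (0,1). Then the probability measure π with π({a}) = p²/(p² + (1−p)²) (and π({b}) = (1−p)²/(p² + (1−p)²)) is stationary for the kernel K^{θ,1,2}: π(A) = ∫_S K^{θ,1,2}(x,A) π(dx) for every A ⊆ S. -/
open MeasureTheory
open scoped ENNReal

theorem measure_eq_of_two_points {S : Type*} [MeasurableSpace S] [MeasurableSingletonClass S]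
    {a b : S} (hab : a ≠ b) (huniv : ∀ s : S, s = a ∨ s = b) (θ : Measure S) :
    θ = θ {a} • Measure.dirac a + θ {b} • Measure.dirac b := by
  have : Finite S := by
    refine Set.finite_univ_iff.mp (Set.Finite.subset (Set.toFinite {a, b}) ?_)
    intro s _
    simpa using huniv s
  refine Measure.ext_of_singleton fun s => ?_
  rcases huniv s with rfl | rfl
  · simp [hab.symm]
  · simp [hab]

theorem K12_of_two_points {S : Type*} [MetricSpace S] [MeasurableSpace S]
    [MeasurableSingletonClass S] {a b : S} (hab : a ≠ b) (huniv : ∀ s : S, s = a ∨ s = b)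
    (θ : Measure S) {A : Set S} (hA : MeasurableSet A) :
    K12 θ a A = θ {a} * (2 * θ {b} + θ {a}) * A.indicator 1 a
      + θ {b} * θ {b} * A.indicator 1 b := by
  have hd : 0 < dist a b := dist_pos.mpr hab
  have gt_a : {z | dist a a < dist a z} = {b} := by
    ext z; rcases huniv z with rfl | rfl <;> simp [hab]
  have eq_a : {z | dist a z = dist a a} = {a} := by
    ext z; simp [eq_comm]
  have gt_b : {z | dist a b < dist a z} = ∅ := by
    ext z; rcases huniv z with rfl | rfl <;> simp [hd.le]
  have eq_b : {z | dist a z = dist a b} = {b} := by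
    ext z; rcases huniv z with rfl | rfl <;> simp [hab]
  unfold K12
  rw [← lintegral_indicator hA]
  conv_lhs => rw [measure_eq_of_two_points hab huniv θ]
  rw [lintegral_add_measure, lintegral_smul_measure, lintegral_smul_measure, lintegral_dirac,
    lintegral_dirac, ← measure_eq_of_two_points hab huniv θ]
  by_cases ha : a ∈ A <;> by_cases hb : b ∈ A <;>
    simp only [Set.indicator, ha, hb, gt_a, eq_a, gt_b, eq_b] <;> simp

theorem stmt_18 {S : Type*} [MetricSpace S] [MeasurableSpace S] [BorelSpace S]
    (a b : S) (hab : a ≠ b) (huniv : ∀ s : S, s = a ∨ s = b)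
    (p : ℝ) (hp0 : 0 < p) (hp1 : p < 1)
    (θ : Measure S) [IsProbabilityMeasure θ] (hθa : θ {a} = ENNReal.ofReal p)
    (π : Measure S)
    (hπ : π = ENNReal.ofReal (p ^ 2 / (p ^ 2 + (1 - p) ^ 2)) • Measure.dirac a +
      ENNReal.ofReal ((1 - p) ^ 2 / (p ^ 2 + (1 - p) ^ 2)) • Measure.dirac b) :
    ∀ A : Set S, MeasurableSet A → π A = ∫⁻ x, K12 θ x A ∂π := by
  intro A hA
  have hq : 0 < 1 - p := sub_pos.mpr hp1
  have hθb : θ {b} = ENNReal.ofReal (1 - p) := by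
    have hcompl : ({b} : Set S) = {a}ᶜ := by
      ext z; rcases huniv z with rfl | rfl <;> simp [hab, hab.symm]
    rw [hcompl, prob_compl_eq_one_sub (measurableSet_singleton a), hθa,
      ENNReal.ofReal_sub _ hp0.le, ENNReal.ofReal_one]
  rw [hπ, lintegral_add_measure, lintegral_smul_measure, lintegral_smul_measure, lintegral_dirac,
    lintegral_dirac, K12_of_two_points hab huniv θ hA,
    K12_of_two_points hab.symm (fun s => (huniv s).symm) θ hA, hθa, hθb]
  simp only [Measure.add_apply, Measure.smul_apply, Measure.dirac_apply' _ hA, smul_eq_mul]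
  have two_eq : (2 : ℝ≥0∞) = ENNReal.ofReal 2 := by simp
  have balance : ∀ r s : ℝ, 0 < r → 0 < s → r + s = 1 →
      ENNReal.ofReal (r ^ 2 / (r ^ 2 + s ^ 2)) =
        ENNReal.ofReal (r ^ 2 / (r ^ 2 + s ^ 2)) * (ENNReal.ofReal r *
          (2 * ENNReal.ofReal s + ENNReal.ofReal r)) +
        ENNReal.ofReal (s ^ 2 / (r ^ 2 + s ^ 2)) * (ENNReal.ofReal r * ENNReal.ofReal r) := by
    intro r s hr hs hrs
    rw [two_eq, ← ENNReal.ofReal_mul (by positivity), ← ENNReal.ofReal_add (by positivity)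
      (by positivity), ← ENNReal.ofReal_mul (by positivity), ← ENNReal.ofReal_mul (by positivity),
      ← ENNReal.ofReal_mul (by positivity), ← ENNReal.ofReal_mul (by positivity),
      ← ENNReal.ofReal_add (by positivity) (by positivity)]
    congr 1
    obtain rfl : s = 1 - r := by linarith
    field_simp
    ring
  have balance_a := balance p (1 - p) hp0 hq (by ring)
  have balance_b := balance (1 - p) p hq hp0 (by ring)
  rw [add_comm ((1 - p) ^ 2) (p ^ 2)] at balance_b
  refine (congrArg₂ (fun u v => u * A.indicator 1 a + v * A.indicator 1 b)
    balance_a balance_b).trans ?_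
  ring
end
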